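/- arXiv:2308.09645 — 2 statements merged into one kernel-verified Lean document; each statement's English description precedes it below -/
import Mathlib

section
/- For any finite tree T on at least two vertices, dmg(T) = rad(T) − 1. -/
open SimpleGraph

/-!
Formalization of the game of Cops and Robber (one cop, one robber) and the damage number.

Round 0: the cop chooses a starting vertex, then the robber chooses a starting vertex.
In each subsequent round the cop moves to an adjacent vertex or passes, after which the
robber moves to an adjacent vertex or passes.  Strategies are modelled as functions of
the full history of positions (most recent first).
-/

/-- A cop strategy: an initial vertex together with a move function taking the history of
cop positions (most recent first, nonempty) and of robber positions (most recent first)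
to the cop's next position. -/
structure CopStrategy (V : Type*) where
  init : V
  move : List V → List V → V

/-- A robber strategy: an initial vertex chosen in response to the cop's initial vertex,
together with a move function taking the history of cop positions (most recent first,
including the cop's move from the current round) and of robber positions (most recent
first) to the robber's next position. -/
structure RobberStrategy (V : Type*) where
  init : V → V
  move : List V → List V → V

variable {V : Type*}

/-- A cop move function is legal for `G` if from any position it either passes or
moves along an edge of `G`. -/
def LegalCopMove (G : SimpleGraph V) (cs : List V → List V → V) : Prop :=
  ∀ (c : V) (ch rh : List V), cs (c :: ch) rh = c ∨ G.Adj c (cs (c :: ch) rh)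

/-- A robber move function is legal for `G` if from any position it either passes or
moves along an edge of `G`. -/
def LegalRobMove (G : SimpleGraph V) (rs : List V → List V → V) : Prop :=
  ∀ (r : V) (ch rh : List V), rs ch (r :: rh) = r ∨ G.Adj r (rs ch (r :: rh))

/-- A legal cop strategy: every move passes or goes along an edge. -/
def CopStrategy.Legal (G : SimpleGraph V) (CS : CopStrategy V) : Prop :=
  LegalCopMove G CS.move

/-- A legal robber strategy: every move passes or goes along an edge. -/
def RobberStrategy.Legal (G : SimpleGraph V) (RS : RobberStrategy V) : Prop :=
  LegalRobMove G RS.move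

/-- `play CS RS n = (cₙ, rₙ, earlier cop positions, earlier robber positions)`:
the state of the game after round `n`, when the cop plays `CS` and the robber plays `RS`.
In each round the cop moves first, then the robber moves. -/
def play (CS : CopStrategy V) (RS : RobberStrategy V) : ℕ → V × V × List V × List V
  | 0 => (CS.init, RS.init CS.init, [], [])
  | n + 1 =>
    let p := play CS RS n
    let c := CS.move (p.1 :: p.2.2.1) (p.2.1 :: p.2.2.2)
    let r := RS.move (c :: p.1 :: p.2.2.1) (p.2.1 :: p.2.2.2)
    (c, r, p.1 :: p.2.2.1, p.2.1 :: p.2.2.2)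

/-- The cop's position after its move in round `n`. -/
def copPos (CS : CopStrategy V) (RS : RobberStrategy V) (n : ℕ) : V := (play CS RS n).1

/-- The robber's position after its move in round `n`. -/
def robPos (CS : CopStrategy V) (RS : RobberStrategy V) (n : ℕ) : V := (play CS RS n).2.1

/-- The robber damages `v`: at the end of some round `n` the robber occupies `v`, having
never been captured up to that point (neither by moving onto the cop, nor by the cop's
move in any round up to and including round `n + 1`); it then passes or moves in
round `n + 1`, damaging `v`. -/
def Damages (CS : CopStrategy V) (RS : RobberStrategy V) (v : V) : Prop :=
  ∃ n, robPos CS RS n = v ∧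
    ∀ k ≤ n, copPos CS RS k ≠ robPos CS RS k ∧ copPos CS RS (k + 1) ≠ robPos CS RS k

/-- The set of vertices damaged by the robber during the play of `CS` against `RS`. -/
def damageSet (CS : CopStrategy V) (RS : RobberStrategy V) : Set V :=
  {v | Damages CS RS v}

/-- The damage number of `G`: the minimum over legal cop strategies of the maximum over
legal robber strategies of the number of distinct damaged vertices. -/
noncomputable def dmg (G : SimpleGraph V) : ℕ :=
  sInf { n | ∃ CS : CopStrategy V, CS.Legal G ∧
    ∀ RS : RobberStrategy V, RS.Legal G → (damageSet CS RS).ncard ≤ n }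

/-- A cop strategy passes during the first round. -/
def CopStrategy.PassesFirst (CS : CopStrategy V) : Prop :=
  ∀ r : V, CS.move [CS.init] [r] = CS.init

/-- The damage number of `G` when the cop is required to pass during the first round. -/
noncomputable def dmg' (G : SimpleGraph V) : ℕ :=
  sInf { n | ∃ CS : CopStrategy V, CS.Legal G ∧ CS.PassesFirst ∧
    ∀ RS : RobberStrategy V, RS.Legal G → (damageSet CS RS).ncard ≤ n }

/-- The eccentricity of a vertex: the maximum distance from `u` to any vertex. -/
noncomputable def ecc (G : SimpleGraph V) (u : V) : ℕ := sSup (Set.range (G.dist u))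

/-- The radius of a graph: the minimum eccentricity over all vertices. -/
noncomputable def gRadius (G : SimpleGraph V) : ℕ := sInf (Set.range (ecc G))

section Helpers

lemma exists_step {V : Type*} {G : SimpleGraph V} (hG : G.Connected) {u v : V} (h : u ≠ v) :
    ∃ w, G.Adj u w ∧ G.dist w v + 1 = G.dist u v := by
  obtain ⟨p, hp⟩ := hG.exists_walk_length_eq_dist u v
  cases p with
  | nil => exact absurd rfl h
  | @cons _ w _ hadj q =>
    refine ⟨w, hadj, ?_⟩
    have h1 := dist_le q
    have h2 : G.dist u v ≤ G.dist u w + G.dist w v := hG.dist_triangle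
    have h3 := dist_eq_one_iff_adj.2 hadj
    simp only [Walk.length_cons] at hp
    omega

lemma parent_unique {V : Type*} {T : SimpleGraph V} (hT : T.IsTree) {c r x y : V}
    (hx : T.Adj x r) (hy : T.Adj y r) (hdx : T.dist c r = T.dist c x + 1)
    (hdy : T.dist c r = T.dist c y + 1) : x = y := by
  obtain ⟨p, hp⟩ := hT.connected.exists_walk_length_eq_dist c x
  obtain ⟨q, hq⟩ := hT.connected.exists_walk_length_eq_dist c y
  have h1 : (p.concat hx).IsPath :=
    Walk.isPath_of_length_eq_dist _ (by rw [Walk.length_concat]; omega)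
  have h2 : (q.concat hy).IsPath :=
    Walk.isPath_of_length_eq_dist _ (by rw [Walk.length_concat]; omega)
  have h3 := (hT.existsUnique_path c r).unique h1 h2
  have h4 := congrArg Walk.penultimate h3
  simpa using h4

/-- If `c` separates the start `s` from the robber's vertex `r`, it still does after a move. -/
lemma between_step {V : Type*} {T : SimpleGraph V} (hT : T.IsTree) {s c r r' : V}
    (hb : T.dist s r = T.dist s c + T.dist c r) (hne : c ≠ r) (hr : r' = r ∨ T.Adj r r') :
    T.dist s r' = T.dist s c + T.dist c r' := by
  rcases hr with rfl | hr
  · exact hb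
  have t1 : T.dist s r' ≤ T.dist s c + T.dist c r' := hT.connected.dist_triangle
  have t2 : T.dist c r' ≤ T.dist c r + T.dist r r' := hT.connected.dist_triangle
  have h1 := dist_eq_one_iff_adj.2 hr
  rcases hT.dist_eq_dist_add_one_of_adj s hr with h | h
  · obtain ⟨w, hw, hd⟩ := exists_step hT.connected hne.symm
    rw [dist_comm, dist_comm (u := r)] at hd
    have t3 : T.dist s w ≤ T.dist s c + T.dist c w := hT.connected.dist_triangle
    have t4 : T.dist s r ≤ T.dist s w + T.dist w r := hT.connected.dist_triangle
    have h5 := dist_eq_one_iff_adj.2 hw.symm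
    have : r' = w := parent_unique hT hr.symm hw.symm h (by omega)
    subst this
    omega
  · omega

lemma dist_le_ecc {V : Type*} [Fintype V] (G : SimpleGraph V) (u v : V) :
    G.dist u v ≤ ecc G u :=
  le_csSup (Set.finite_range _).bddAbove ⟨v, rfl⟩

lemma exists_dist_eq_ecc {V : Type*} [Fintype V] [Nonempty V] (G : SimpleGraph V) (u : V) :
    ∃ v, G.dist u v = ecc G u :=
  Nat.sSup_mem (Set.range_nonempty (G.dist u)) (Set.finite_range _).bddAbove

open Classical in
/-- The cop that always walks towards the robber. -/
noncomputable def chaser {V : Type*} {G : SimpleGraph V} (hG : G.Connected) (s : V) :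
    CopStrategy V where
  init := s
  move ch rh := match ch, rh with
    | c :: _, r :: _ => if h : c = r then c else (exists_step hG h).choose
    | c :: _, [] => c
    | [], _ => s

lemma chaser_legal {V : Type*} {G : SimpleGraph V} (hG : G.Connected) (s : V) :
    (chaser hG s).Legal G := by
  intro c ch rh
  cases rh with
  | nil => left; rfl
  | cons r rh =>
    by_cases h : c = r
    · left; simp [chaser, h]
    · right; simpa [chaser, h] using (exists_step hG h).choose_spec.1

lemma copPos_succ {V : Type*} (CS : CopStrategy V) (RS : RobberStrategy V) (n : ℕ) :
    copPos CS RS (n + 1) = CS.move (copPos CS RS n :: (play CS RS n).2.2.1)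
      (robPos CS RS n :: (play CS RS n).2.2.2) := rfl

lemma robPos_succ {V : Type*} (CS : CopStrategy V) (RS : RobberStrategy V) (n : ℕ) :
    robPos CS RS (n + 1) =
      RS.move (copPos CS RS (n + 1) :: copPos CS RS n :: (play CS RS n).2.2.1)
      (robPos CS RS n :: (play CS RS n).2.2.2) := rfl

lemma chaser_step {V : Type*} {G : SimpleGraph V} (hG : G.Connected) (s : V)
    (RS : RobberStrategy V) (n : ℕ)
    (h : copPos (chaser hG s) RS n ≠ robPos (chaser hG s) RS n) :
    G.Adj (copPos (chaser hG s) RS n) (copPos (chaser hG s) RS (n + 1)) ∧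
    G.dist (copPos (chaser hG s) RS (n + 1)) (robPos (chaser hG s) RS n) + 1
      = G.dist (copPos (chaser hG s) RS n) (robPos (chaser hG s) RS n) := by
  have hm : copPos (chaser hG s) RS (n + 1) = (exists_step hG h).choose := by
    rw [copPos_succ]
    exact dif_neg h
  rw [hm]
  exact (exists_step hG h).choose_spec

/-- After the cop's move the cop separates its start from the robber. -/
lemma chaser_half {V : Type*} {T : SimpleGraph V} (hT : T.IsTree) (s : V)
    (RS : RobberStrategy V) (n : ℕ)
    (h : copPos (chaser hT.connected s) RS n ≠ robPos (chaser hT.connected s) RS n)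
    (h1 : T.dist s (copPos (chaser hT.connected s) RS n) = n)
    (h2 : T.dist s (robPos (chaser hT.connected s) RS n) =
      n + T.dist (copPos (chaser hT.connected s) RS n) (robPos (chaser hT.connected s) RS n)) :
    T.dist s (copPos (chaser hT.connected s) RS (n + 1)) = n + 1 ∧
    T.dist s (robPos (chaser hT.connected s) RS n) =
      n + 1 + T.dist (copPos (chaser hT.connected s) RS (n + 1))
        (robPos (chaser hT.connected s) RS n) := by
  obtain ⟨ha, hd⟩ := chaser_step hT.connected s RS n h
  set c := copPos (chaser hT.connected s) RS n
  set c' := copPos (chaser hT.connected s) RS (n + 1)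
  set r := robPos (chaser hT.connected s) RS n
  have t1 : T.dist s c' ≤ T.dist s c + T.dist c c' := hT.connected.dist_triangle
  have t2 : T.dist s r ≤ T.dist s c' + T.dist c' r := hT.connected.dist_triangle
  have h3 := dist_eq_one_iff_adj.2 ha
  omega

lemma chaser_inv {V : Type*} {T : SimpleGraph V} (hT : T.IsTree) (s : V)
    (RS : RobberStrategy V) (hRS : RS.Legal T) (n : ℕ)
    (h : ∀ k < n, copPos (chaser hT.connected s) RS k ≠ robPos (chaser hT.connected s) RS k ∧
      copPos (chaser hT.connected s) RS (k + 1) ≠ robPos (chaser hT.connected s) RS k) :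
    T.dist s (copPos (chaser hT.connected s) RS n) = n ∧
    T.dist s (robPos (chaser hT.connected s) RS n) =
      n + T.dist (copPos (chaser hT.connected s) RS n)
        (robPos (chaser hT.connected s) RS n) := by
  induction n with
  | zero =>
    have : copPos (chaser hT.connected s) RS 0 = s := rfl
    simp [this]
  | succ n ih =>
    obtain ⟨i1, i2⟩ := ih (fun k hk => h k (by omega))
    obtain ⟨g1, g2⟩ := h n (by omega)
    obtain ⟨j1, j2⟩ := chaser_half hT s RS n g1 i1 i2
    refine ⟨j1, ?_⟩
    have := between_step hT (j2.trans (by rw [j1])) g2 (r' := robPos (chaser hT.connected s) RS (n + 1))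
      (by rw [robPos_succ]; exact hRS _ _ _)
    rw [this, j1]

lemma chaser_bound {V : Type*} [Fintype V] {T : SimpleGraph V} (hT : T.IsTree) (s : V)
    (RS : RobberStrategy V) (hRS : RS.Legal T) :
    (damageSet (chaser hT.connected s) RS).ncard ≤ ecc T s - 1 := by
  classical
  have hsub : damageSet (chaser hT.connected s) RS ⊆
      ((Finset.range (ecc T s - 1)).image (robPos (chaser hT.connected s) RS) : Finset V) := by
    rintro v ⟨n, rfl, hn⟩
    obtain ⟨i1, i2⟩ := chaser_inv hT s RS hRS n (fun k hk => hn k hk.le)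
    obtain ⟨g1, g2⟩ := hn n le_rfl
    obtain ⟨-, j2⟩ := chaser_half hT s RS n g1 i1 i2
    have := hT.connected.pos_dist_of_ne g2
    have := dist_le_ecc T s (robPos (chaser hT.connected s) RS n)
    simp only [Finset.coe_image, Finset.coe_range]
    exact ⟨n, by simp only [Set.mem_Iio]; omega, rfl⟩
  calc _ ≤ _ := Set.ncard_le_ncard hsub (Finset.finite_toSet _)
    _ ≤ _ := by
      rw [Set.ncard_coe_finset]
      exact Finset.card_image_le.trans (by simp)

lemma exists_geodesic {V : Type*} {G : SimpleGraph V} (hG : G.Connected) (u v : V) :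
    ∃ p : ℕ → V, (∀ i ≤ G.dist u v, G.dist u (p i) = i) ∧
      ∀ i < G.dist u v, G.Adj (p i) (p (i + 1)) := by
  obtain ⟨w, hw⟩ := hG.exists_walk_length_eq_dist u v
  refine ⟨w.getVert, fun i hi => ?_, fun i hi => w.adj_getVert_succ (by omega)⟩
  have h1 := dist_le (w.take i)
  have h2 := dist_le (w.drop i)
  have h3 : G.dist u v ≤ G.dist u (w.getVert i) + G.dist (w.getVert i) v := hG.dist_triangle
  rw [Walk.take_length] at h1
  rw [Walk.drop_length] at h2
  omega

open Classical in
/-- The robber that runs away along `p`. -/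
noncomputable def runner {V : Type*} (G : SimpleGraph V) (s : V) (d : ℕ) (p : ℕ → V) :
    RobberStrategy V where
  init _ := p 2
  move _ rh := match rh with
    | r :: _ => if r = p (G.dist s r) ∧ G.dist s r < d then p (G.dist s r + 1) else r
    | [] => s

lemma runner_legal {V : Type*} (G : SimpleGraph V) (s : V) (d : ℕ) (p : ℕ → V)
    (hp : ∀ i < d, G.Adj (p i) (p (i + 1))) : (runner G s d p).Legal G := by
  intro r ch rh
  by_cases h : r = p (G.dist s r) ∧ G.dist s r < d
  · right
    have := hp _ h.2
    rw [← h.1] at this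
    simpa only [runner, if_pos h] using this
  · left
    simp only [runner, if_neg h]

lemma copPos_dist {V : Type*} {G : SimpleGraph V} (hG : G.Connected) (CS : CopStrategy V)
    (hCS : CS.Legal G) (RS : RobberStrategy V) (n : ℕ) :
    G.dist CS.init (copPos CS RS n) ≤ n := by
  induction n with
  | zero =>
    have : copPos CS RS 0 = CS.init := rfl
    simp [this]
  | succ n ih =>
    have h := hCS (copPos CS RS n) (play CS RS n).2.2.1 (robPos CS RS n :: (play CS RS n).2.2.2)
    rw [← copPos_succ] at h
    rcases h with h | h
    · rw [h]; omega
    · have h1 := dist_eq_one_iff_adj.2 h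
      have := hG.dist_triangle (u := CS.init) (v := copPos CS RS n) (w := copPos CS RS (n + 1))
      omega

lemma runner_pos {V : Type*} (G : SimpleGraph V) (CS : CopStrategy V) (d : ℕ) (p : ℕ → V)
    (hd : ∀ i ≤ d, G.dist CS.init (p i) = i) (n : ℕ) (hn : n + 2 ≤ d) :
    robPos CS (runner G CS.init d p) n = p (n + 2) := by
  induction n with
  | zero => rfl
  | succ n ih =>
    rw [robPos_succ, ih (by omega)]
    have h := hd (n + 2) (by omega)
    simp only [runner, h]
    rw [if_pos ⟨trivial, by omega⟩]

lemma runner_bound {V : Type*} [Fintype V] {G : SimpleGraph V} (hG : G.Connected)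
    (CS : CopStrategy V) (hCS : CS.Legal G) :
    ∃ RS : RobberStrategy V, RS.Legal G ∧ ecc G CS.init - 1 ≤ (damageSet CS RS).ncard := by
  classical
  have := hG.nonempty
  obtain ⟨v, hv⟩ := exists_dist_eq_ecc G CS.init
  obtain ⟨p, hp, hadj⟩ := exists_geodesic hG CS.init v
  rw [hv] at hp hadj
  refine ⟨runner G CS.init (ecc G CS.init) p, runner_legal _ _ _ _ hadj, ?_⟩
  have hsub : ((fun i => p (i + 2)) '' (Finset.range (ecc G CS.init - 1) : Set ℕ)) ⊆
      damageSet CS (runner G CS.init (ecc G CS.init) p) := by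
    intro x hx
    simp only [Finset.coe_range, Set.mem_image, Set.mem_Iio] at hx
    obtain ⟨n, hn, rfl⟩ := hx
    refine ⟨n, runner_pos _ _ _ _ hp n (by omega), fun k hk => ?_⟩
    rw [runner_pos _ _ _ _ hp k (by omega)]
    have h0 := hp (k + 2) (by omega)
    have h1 := copPos_dist hG CS hCS (runner G CS.init (ecc G CS.init) p) k
    have h2 := copPos_dist hG CS hCS (runner G CS.init (ecc G CS.init) p) (k + 1)
    constructor
    · intro h
      rw [h] at h1; omega
    · intro h
      rw [h] at h2; omega
  have hle := Set.ncard_le_ncard hsub (Set.toFinite _)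
  refine le_trans (le_of_eq ?_) hle
  rw [Set.InjOn.ncard_image]
  · rw [Set.ncard_coe_finset, Finset.card_range]
  · intro i hi j hj hij
    simp only [Finset.coe_range, Set.mem_Iio] at hi hj
    have h1 := hp (i + 2) (by omega)
    have h2 := hp (j + 2) (by omega)
    simp only at hij
    rw [hij] at h1
    omega

end Helpers

/-- For any finite tree `T` on at least two vertices, `dmg(T) = rad(T) - 1`. -/
theorem dmg_tree {V : Type*} [Fintype V] (T : SimpleGraph V) (hT : T.IsTree)
    (h2 : 2 ≤ Fintype.card V) : dmg T = gRadius T - 1 := by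
  classical
  have hne := hT.connected.nonempty
  obtain ⟨s, hs⟩ : gRadius T ∈ Set.range (ecc T) := Nat.sInf_mem (Set.range_nonempty _)
  have hmem : gRadius T - 1 ∈ { n | ∃ CS : CopStrategy V, CS.Legal T ∧
      ∀ RS : RobberStrategy V, RS.Legal T → (damageSet CS RS).ncard ≤ n } :=
    ⟨chaser hT.connected s, chaser_legal _ _, fun RS hRS => hs ▸ chaser_bound hT s RS hRS⟩
  refine le_antisymm (Nat.sInf_le hmem) (le_csInf ⟨_, hmem⟩ ?_)
  rintro n ⟨CS, hCS, h⟩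
  obtain ⟨RS, hRS, hle⟩ := runner_bound hT.connected CS hCS
  have h1 : gRadius T ≤ ecc T CS.init := Nat.sInf_le ⟨_, rfl⟩
  have h2 := h RS hRS
  omega
end

section
/- If m, n ≥ 4, then dmg(C_m □ C_n) ≥ max{ dmg(C_m)·|V(C_n)| , dmg(C_n)·|V(C_m)| }, i.e. dmg(C_m □ C_n) ≥ max{ ⌊(m−1)/2⌋·n , ⌊(n−1)/2⌋·m }. -/
open SimpleGraph

variable {V : Type*}

/-! ## Cyclic distance -/

/-- Cyclic distance to zero in `ZMod m`. -/
def cyD (m : ℕ) (z : ZMod m) : ℤ := (z.valMinAbs.natAbs : ℤ)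

theorem cyD_nonneg (m : ℕ) (z : ZMod m) : 0 ≤ cyD m z := by
  unfold cyD; omega

theorem cyD_eq_zero {m : ℕ} [NeZero m] {z : ZMod m} : cyD m z = 0 ↔ z = 0 := by
  unfold cyD
  rw [Int.natCast_eq_zero, Int.natAbs_eq_zero, ZMod.valMinAbs_eq_zero]

theorem cyD_add_le (m : ℕ) (a b : ZMod m) : cyD m (a + b) ≤ cyD m a + cyD m b := by
  unfold cyD
  have := ZMod.natAbs_valMinAbs_add_le a b
  have h2 := Int.natAbs_add_le a.valMinAbs b.valMinAbs
  omega

theorem cyD_neg (m : ℕ) (a : ZMod m) : cyD m (-a) = cyD m a := by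
  unfold cyD
  rw [ZMod.natAbs_valMinAbs_neg]

theorem cyD_eq_min {m : ℕ} [NeZero m] (k : ℤ) (h0 : 0 ≤ k) (h1 : k ≤ m) :
    cyD m (k : ZMod m) = min k (m - k) := by
  have hm : 0 < m := Nat.pos_of_ne_zero (NeZero.ne m)
  obtain ⟨k, rfl⟩ := Int.eq_ofNat_of_zero_le h0
  have h1' : k ≤ m := by exact_mod_cast h1
  unfold cyD
  rw [ZMod.valMinAbs_natAbs_eq_min]
  rcases Nat.lt_or_ge k m with h | h
  · have : ((((k : ℕ) : ℤ) : ZMod m)).val = k := by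
      rw [Int.cast_natCast, ZMod.val_natCast, Nat.mod_eq_of_lt h]
    rw [this]
    omega
  · have : k = m := by omega
    subst this
    simp

theorem cyD_le_half {m : ℕ} [NeZero m] (z : ZMod m) : 2 * cyD m z ≤ m := by
  unfold cyD
  have := ZMod.natAbs_valMinAbs_le z
  omega

theorem cyD_int_le {m : ℕ} [NeZero m] (k : ℤ) : cyD m (k : ZMod m) ≤ |k| := by
  have key : ∀ k : ℕ, cyD m (k : ZMod m) ≤ k := by
    intro k
    induction k with
    | zero => simp [cyD]
    | succ k ih =>
      have h1 : cyD m ((1 : ℤ) : ZMod m) ≤ 1 := by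
        rw [cyD_eq_min 1 (by omega) (by have := Nat.pos_of_ne_zero (NeZero.ne m); omega)]
        exact min_le_left _ _
      have := cyD_add_le m (k : ZMod m) 1
      push_cast at *
      omega
  rcases le_total 0 k with h | h
  · obtain ⟨k, rfl⟩ := Int.eq_ofNat_of_zero_le h
    rw [abs_of_nonneg h]
    have := key k
    simpa using this
  · obtain ⟨j, hj⟩ := Int.eq_ofNat_of_zero_le (neg_nonneg.mpr h)
    rw [abs_of_nonpos h]
    have e : k = -(j : ℤ) := by omega
    subst e
    have := key j
    rw [Int.cast_neg, cyD_neg]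
    simpa using this

theorem cyD_lift {m : ℕ} [NeZero m] (z : ZMod m) :
    ∃ ε : ℤ, (ε = 1 ∨ ε = -1) ∧ z = ((-(ε * cyD m z) : ℤ) : ZMod m) := by
  have h := ZMod.coe_valMinAbs z
  rcases le_total 0 z.valMinAbs with h1 | h1
  · refine ⟨-1, Or.inr rfl, ?_⟩
    have : -(-1 * cyD m z) = z.valMinAbs := by unfold cyD; omega
    rw [this, h]
  · refine ⟨1, Or.inl rfl, ?_⟩
    have : -(1 * cyD m z) = z.valMinAbs := by unfold cyD; omega
    rw [this, h]

theorem lift_nonneg {m : ℕ} [NeZero m] (z : ZMod m) (ε : ℤ) (hε : ε = 1 ∨ ε = -1) :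
    ∃ a : ℤ, 0 ≤ a ∧ a < m ∧ z = ((-(ε * a) : ℤ) : ZMod m) := by
  have hm : 0 < m := Nat.pos_of_ne_zero (NeZero.ne m)
  rcases hε with rfl | rfl
  · refine ⟨((-z).val : ℤ), by omega, by exact_mod_cast ZMod.val_lt _, ?_⟩
    push_cast
    rw [ZMod.natCast_zmod_val]; ring
  · refine ⟨(z.val : ℤ), by omega, by exact_mod_cast ZMod.val_lt _, ?_⟩
    push_cast
    rw [ZMod.natCast_zmod_val]; ring

/-- unit step or no step -/
def UStep (d e : ℤ) : Prop :=
  (d = 0 ∧ (e = 0 ∨ e = 1 ∨ e = -1)) ∨ (e = 0 ∧ (d = 1 ∨ d = -1))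

/-- `L¹` ball -/
def LBall (u v s : ℤ) : Prop := u + v ≤ s ∧ u - v ≤ s ∧ -u + v ≤ s ∧ -u - v ≤ s

/-- closed adjacency in the torus -/
def Near {m n : ℕ} (c c' : ZMod m × ZMod n) : Prop :=
  ∃ d e : ℤ, UStep d e ∧ c'.1 = c.1 + (d : ZMod m) ∧ c'.2 = c.2 + (e : ZMod n)

/-- The tree of robber-alive positions against a fixed cop. -/
structure TGame (m n : ℕ) where
  T : Type
  pos : T → ZMod m × ZMod n
  cp : T → ZMod m × ZMod n
  dam : T → Finset (ZMod m × ZMod n)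
  le : T → T → Prop
  le_refl : ∀ t, le t t
  le_trans : ∀ {a b c}, le a b → le b c → le a c
  dam_mono : ∀ {a b}, le a b → dam a ⊆ dam b
  pos_mem : ∀ t, pos t ∈ dam t
  alive : ∀ t, cp t ≠ pos t
  step : ∀ t v, Near (pos t) v → ¬ Near (cp t) v →
    ∃ t', le t t' ∧ pos t' = v ∧ Near (cp t) (cp t')
  init : ∃ c : ZMod m × ZMod n, ∀ v, ¬ Near c v → ∃ t, pos t = v ∧ Near c (cp t)

namespace TGame

/-- exchange the coordinates -/
def swap {m n : ℕ} (G : TGame m n) : TGame n m where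
  T := G.T
  pos t := (G.pos t).swap
  cp t := (G.cp t).swap
  dam t := (G.dam t).map ⟨Prod.swap, Prod.swap_injective⟩
  le := G.le
  le_refl := G.le_refl
  le_trans := G.le_trans
  dam_mono h := Finset.map_subset_map.mpr (G.dam_mono h)
  pos_mem t := Finset.mem_map_of_mem _ (G.pos_mem t)
  alive t h := G.alive t (Prod.swap_injective h)
  step t v h1 h2 := by
    have key : ∀ a b : ZMod m × ZMod n, Near a b → Near a.swap b.swap := by
      rintro a b ⟨d, e, h, h3, h4⟩
      exact ⟨e, d, by unfold UStep at *; omega, h4, h3⟩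
    have key2 : ∀ a b : ZMod n × ZMod m, Near a b → Near a.swap b.swap := by
      rintro a b ⟨d, e, h, h3, h4⟩
      exact ⟨e, d, by unfold UStep at *; omega, h4, h3⟩
    obtain ⟨t', ha, hb, hc⟩ := G.step t v.swap (by simpa using key2 _ _ h1)
      (fun h => h2 (by simpa using key _ _ h))
    exact ⟨t', ha, by rw [hb]; simp, key _ _ hc⟩
  init := by
    have key : ∀ a b : ZMod m × ZMod n, Near a b → Near a.swap b.swap := by
      rintro a b ⟨d, e, h, h3, h4⟩
      exact ⟨e, d, by unfold UStep at *; omega, h4, h3⟩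
    obtain ⟨c, hc⟩ := G.init
    refine ⟨c.swap, fun v hv => ?_⟩
    obtain ⟨t, h1, h2⟩ := hc v.swap (fun h => hv (by simpa using key _ _ h))
    exact ⟨t, by rw [h1]; simp, key _ _ h2⟩

section
variable {m n : ℕ} (G : TGame m n)

/-- vertical cyclic distance cop-robber -/
def hh (t : G.T) : ℤ := cyD n ((G.cp t).2 - (G.pos t).2)
/-- horizontal cyclic distance cop-robber -/
def gg (t : G.T) : ℤ := cyD m ((G.cp t).1 - (G.pos t).1)
/-- the cop is `a` behind the robber, horizontally, with respect to direction `ε` -/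
def HR (ε : ℤ) (t : G.T) (a : ℤ) : Prop :=
  (G.cp t).1 - (G.pos t).1 = ((-(ε * a) : ℤ) : ZMod m)
/-- the cop is `w` behind the robber, vertically, with respect to direction `ε` -/
def VR (ε : ℤ) (t : G.T) (w : ℤ) : Prop :=
  (G.cp t).2 - (G.pos t).2 = ((-(ε * w) : ℤ) : ZMod n)

theorem hh_nonneg (t : G.T) : 0 ≤ G.hh t := cyD_nonneg _ _
theorem gg_nonneg (t : G.T) : 0 ≤ G.gg t := cyD_nonneg _ _

theorem swap_hh (t : G.T) : G.swap.hh t = G.gg t := rfl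
theorem swap_gg (t : G.T) : G.swap.gg t = G.hh t := rfl
theorem swap_HR (ε : ℤ) (t : G.T) (a : ℤ) : G.swap.HR ε t a ↔ G.VR ε t a := Iff.rfl

theorem HR_flip {ε : ℤ} {t : G.T} {a : ℤ} (h : G.HR ε t a) : G.HR (-ε) t (m - a) := by
  unfold HR at *
  rw [h]
  push_cast
  simp

theorem VR_flip {ε : ℤ} {t : G.T} {a : ℤ} (h : G.VR ε t a) : G.VR (-ε) t (n - a) := by
  unfold VR at *
  rw [h]
  push_cast
  simp

theorem cyD_signed {m : ℕ} (ε a : ℤ) (hε : ε = 1 ∨ ε = -1) :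
    cyD m ((-(ε * a) : ℤ) : ZMod m) = cyD m (a : ZMod m) := by
  rcases hε with rfl | rfl
  · rw [Int.cast_neg, cyD_neg]; simp
  · simp

theorem gg_of_HR [NeZero m] {ε : ℤ} (hε : ε = 1 ∨ ε = -1) {t : G.T} {a : ℤ} (h : G.HR ε t a)
    (h0 : 0 ≤ a) (h1 : a ≤ m) : G.gg t = min a (m - a) := by
  unfold gg
  rw [h, cyD_signed _ _ hε, cyD_eq_min a h0 h1]

theorem hh_of_VR [NeZero n] {ε : ℤ} (hε : ε = 1 ∨ ε = -1) {t : G.T} {w : ℤ} (h : G.VR ε t w)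
    (h0 : 0 ≤ w) (h1 : w ≤ n) : G.hh t = min w (n - w) :=
  G.swap.gg_of_HR hε h h0 h1

theorem exists_HR [NeZero m] (ε : ℤ) (hε : ε = 1 ∨ ε = -1) (t : G.T) :
    ∃ a : ℤ, 0 ≤ a ∧ a < m ∧ G.HR ε t a := lift_nonneg _ _ hε

theorem exists_VR [NeZero n] (ε : ℤ) (hε : ε = 1 ∨ ε = -1) (t : G.T) :
    ∃ a : ℤ, 0 ≤ a ∧ a < n ∧ G.VR ε t a := lift_nonneg _ _ hε

theorem exists_HR_min [NeZero m] (t : G.T) :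
    ∃ ε : ℤ, (ε = 1 ∨ ε = -1) ∧ G.HR ε t (G.gg t) := cyD_lift _

theorem exists_VR_min [NeZero n] (t : G.T) :
    ∃ ε : ℤ, (ε = 1 ∨ ε = -1) ∧ G.VR ε t (G.hh t) := cyD_lift _

theorem not_both [NeZero m] [NeZero n] (t : G.T) : ¬ (G.hh t = 0 ∧ G.gg t = 0) := by
  rintro ⟨h1, h2⟩
  rw [hh, cyD_eq_zero, sub_eq_zero] at h1
  rw [gg, cyD_eq_zero, sub_eq_zero] at h2
  exact G.alive t (Prod.ext h2 h1)

theorem dvd_small {m : ℕ} {z : ℤ} (h : ((z : ℤ) : ZMod m) = 0) (h1 : 0 < z) (h2 : z < m) : False := by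
  rw [ZMod.intCast_zmod_eq_zero_iff_dvd] at h
  have := Int.le_of_dvd h1 h
  omega

/-- one horizontal robber step -/
theorem hstep [NeZero m] [NeZero n] {ε : ℤ} (hε : ε = 1 ∨ ε = -1) {t : G.T} {a : ℤ}
    (h : G.HR ε t a) (h1 : 2 ≤ a + 1 + G.hh t) (h2 : 2 ≤ m - a - 1 + G.hh t) :
    ∃ t', G.le t t' ∧ G.pos t' = ((G.pos t).1 + (ε : ZMod m), (G.pos t).2) ∧
      Near (G.cp t) (G.cp t') ∧
      ∃ a', G.HR ε t' a' ∧ LBall (a' - (a + 1)) (G.hh t' - G.hh t) 1 ∧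
        (a' = a + 1 ∨ (G.cp t').2 = (G.cp t).2) := by
  have hh0 := G.hh_nonneg t
  have hnear : ¬ Near (G.cp t) ((G.pos t).1 + (ε : ZMod m), (G.pos t).2) := by
    rintro ⟨d, e, hu, hx, hy⟩
    simp only at hx hy
    have hhe : G.hh t = cyD n ((e : ℤ) : ZMod n) := by
      unfold hh
      rw [← cyD_neg]
      congr 1
      rw [hy]; ring
    have hle : G.hh t ≤ |e| := by rw [hhe]; exact cyD_int_le e
    have hx' : ((ε * (a + 1) - d : ℤ) : ZMod m) = 0 := by
      unfold HR at h
      push_cast at h ⊢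
      have : (G.cp t).1 = (G.pos t).1 - ε * a := by rw [sub_eq_iff_eq_add] at h; rw [h]; ring
      rw [this] at hx
      linear_combination hx
    have hε' : ((a + 1 - ε * d : ℤ) : ZMod m) = 0 := by
      have e1 : (a + 1 - ε * d : ℤ) = ε * (ε * (a + 1) - d) := by
        rcases hε with rfl | rfl <;> ring
      rw [e1, Int.cast_mul, hx', mul_zero]
    have hbd : |e| + |ε * d| ≤ 1 := by
      rcases hu with ⟨rfl, rfl | rfl | rfl⟩ | ⟨rfl, rfl | rfl⟩ <;> rcases hε with rfl | rfl <;> simp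
    have := abs_nonneg e
    have h5 := abs_le.mp (_root_.le_refl |ε * d|)
    exact dvd_small hε' (by omega) (by omega)
  obtain ⟨t', hle, hp, hc⟩ := G.step t _ (⟨ε, 0, by unfold UStep; omega, rfl, by simp⟩) hnear
  refine ⟨t', hle, hp, hc, ?_⟩
  obtain ⟨d, e, hu, hx, hy⟩ := hc
  refine ⟨a + 1 - ε * d, ?_, ?_, ?_⟩
  · unfold HR at *
    rw [hp, hx]
    have : (G.cp t).1 = (G.pos t).1 - ε * a := by
      push_cast at h; rw [sub_eq_iff_eq_add] at h; rw [h]; ring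
    rw [this]
    have e2 : ((ε * ε : ℤ) : ZMod m) = 1 := by rcases hε with rfl | rfl <;> simp
    push_cast at e2 ⊢
    linear_combination -(d : ZMod m) * e2
  · have e1 : G.hh t' ≤ G.hh t + |e| := by
      unfold hh
      rw [hp, hy]
      have := cyD_add_le n ((G.cp t).2 - (G.pos t).2) (e : ZMod n)
      have h3 := cyD_int_le (m := n) e
      have h4 : (G.cp t).2 + (e : ZMod n) - (G.pos t).2 = (G.cp t).2 - (G.pos t).2 + (e : ZMod n) := by ring
      simp only [h4]
      omega
    have e2 : G.hh t ≤ G.hh t' + |e| := by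
      unfold hh
      rw [hp, hy]
      have := cyD_add_le n ((G.cp t).2 + (e : ZMod n) - (G.pos t).2) (-(e : ZMod n))
      rw [cyD_neg] at this
      have h3 := cyD_int_le (m := n) e
      have h4 : (G.cp t).2 + (e : ZMod n) - (G.pos t).2 + -(e : ZMod n) = (G.cp t).2 - (G.pos t).2 := by ring
      rw [h4] at this
      simp only
      omega
    have hbd : |e| + |ε * d| ≤ 1 := by
      rcases hu with ⟨rfl, rfl | rfl | rfl⟩ | ⟨rfl, rfl | rfl⟩ <;> rcases hε with rfl | rfl <;> simp
    have h5 := abs_le.mp (_root_.le_refl |ε * d|)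
    unfold LBall
    omega
  · rcases hu with ⟨rfl, _⟩ | ⟨rfl, _⟩
    · left; ring
    · right; rw [hy]; simp

theorem vstep [NeZero m] [NeZero n] {ε : ℤ} (hε : ε = 1 ∨ ε = -1) {t : G.T} {w : ℤ}
    (h : G.VR ε t w) (h1 : 2 ≤ w + 1 + G.gg t) (h2 : 2 ≤ n - w - 1 + G.gg t) :
    ∃ t', G.le t t' ∧ G.pos t' = ((G.pos t).1, (G.pos t).2 + (ε : ZMod n)) ∧
      ∃ w', G.VR ε t' w' ∧ LBall (w' - (w + 1)) (G.gg t' - G.gg t) 1 ∧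
        (w' = w + 1 ∨ (G.cp t').1 = (G.cp t).1) := by
  obtain ⟨t', a, b, _, d⟩ := G.swap.hstep hε (t := t) (a := w) h h1 h2
  refine ⟨t', a, ?_, d⟩
  have := congrArg Prod.swap b
  simpa [swap] using this

/-- straight horizontal run -/
theorem hrun [NeZero m] [NeZero n] {ε : ℤ} (hε : ε = 1 ∨ ε = -1) (s : ℕ) : ∀ {t : G.T} {a : ℤ},
    G.HR ε t a → 1 ≤ a + G.hh t → 2 * s + 1 ≤ m - a + G.hh t →
    ∃ t', G.le t t' ∧ G.pos t' = ((G.pos t).1 + (ε : ZMod m) * s, (G.pos t).2) ∧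
      ∃ a', G.HR ε t' a' ∧ LBall (a' - (a + s)) (G.hh t' - G.hh t) s := by
  induction s with
  | zero =>
    intro t a h _ _
    exact ⟨t, G.le_refl t, by simp, a, h, by unfold LBall; simp⟩
  | succ s ih =>
    intro t a h h1 h2
    push_cast at h2
    obtain ⟨t1, l1, p1, _, a1, r1, b1, _⟩ := G.hstep hε h (by omega) (by omega)
    unfold LBall at b1
    obtain ⟨t2, l2, p2, a2, r2, b2⟩ := ih r1 (by omega) (by omega)
    refine ⟨t2, G.le_trans l1 l2, ?_, a2, r2, ?_⟩
    · rw [p2, p1]; push_cast; ext <;> simp; ring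
    · unfold LBall at *; push_cast; omega

theorem vrun [NeZero m] [NeZero n] {ε : ℤ} (hε : ε = 1 ∨ ε = -1) (s : ℕ) {t : G.T} {w : ℤ}
    (h : G.VR ε t w) (h1 : 1 ≤ w + G.gg t) (h2 : 2 * s + 1 ≤ n - w + G.gg t) :
    ∃ t', G.le t t' ∧ G.pos t' = ((G.pos t).1, (G.pos t).2 + (ε : ZMod n) * s) := by
  obtain ⟨t', a, b, _⟩ := G.swap.hrun hε s (t := t) (a := w) h h1 h2
  refine ⟨t', a, ?_⟩
  have := congrArg Prod.swap b
  simpa [swap] using this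

/-- maximal element -/
theorem exists_max [NeZero m] [NeZero n] (P : G.T → Prop) (h : ∃ t, P t) :
    ∃ t, P t ∧ ∀ t', G.le t t' → P t' → G.dam t' = G.dam t := by
  classical
  have hb : ∃ k, ∃ t, P t ∧ (Fintype.card (ZMod m × ZMod n)) - (G.dam t).card = k := by
    obtain ⟨t, ht⟩ := h
    exact ⟨_, t, ht, rfl⟩
  obtain ⟨t, ht, hk⟩ := Nat.find_spec hb
  refine ⟨t, ht, fun t' hl hp => ?_⟩
  have h1 := Nat.find_min' hb ⟨t', hp, rfl⟩
  have h2 := G.dam_mono hl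
  have h3 : (G.dam t').card ≤ Fintype.card (ZMod m × ZMod n) := Finset.card_le_univ _
  have h4 := Finset.card_le_card h2
  exact (Finset.eq_of_subset_of_card_le h2 (by omega)).symm

/-- a lap in a row -/
theorem lap [NeZero m] {ε : ℤ} (hε : ε = 1 ∨ ε = -1) (P : G.T → Prop)
    (hP : ∀ t, P t → ∃ t', G.le t t' ∧ P t' ∧ G.pos t' = ((G.pos t).1 + (ε : ZMod m), (G.pos t).2))
    (t : G.T) (ht : P t) :
    ∃ t', G.le t t' ∧ P t' ∧ (G.pos t').2 = (G.pos t).2 ∧ ∀ x, (x, (G.pos t).2) ∈ G.dam t' := by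
  have key : ∀ k : ℕ, ∃ t', G.le t t' ∧ P t' ∧
      G.pos t' = ((G.pos t).1 + (ε : ZMod m) * k, (G.pos t).2) ∧
      ∀ i : ℕ, i ≤ k → ((G.pos t).1 + (ε : ZMod m) * i, (G.pos t).2) ∈ G.dam t' := by
    intro k
    induction k with
    | zero =>
      refine ⟨t, G.le_refl t, ht, by simp, fun i hi => ?_⟩
      have : i = 0 := by omega
      subst this
      simpa using G.pos_mem t
    | succ k ih =>
      obtain ⟨t1, l1, p1, e1, d1⟩ := ih
      obtain ⟨t2, l2, p2, e2⟩ := hP t1 p1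
      have e3 : G.pos t2 = ((G.pos t).1 + (ε : ZMod m) * ((k + 1 : ℕ) : ZMod m), (G.pos t).2) := by
        rw [e2, e1]; push_cast; ext <;> simp; ring
      refine ⟨t2, G.le_trans l1 l2, p2, e3, fun i hi => ?_⟩
      rcases Nat.lt_or_ge i (k + 1) with h | h
      · exact G.dam_mono l2 (d1 i (by omega))
      · have : i = k + 1 := by omega
        subst this
        rw [← e3]; exact G.pos_mem t2
  obtain ⟨t', l, p, e, d⟩ := key m
  refine ⟨t', l, p, by rw [e], fun x => ?_⟩
  have := d ((ε : ZMod m) * (x - (G.pos t).1)).val (le_of_lt (ZMod.val_lt _))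
  rw [ZMod.natCast_zmod_val, ← mul_assoc] at this
  have e2 : (ε : ZMod m) * ε = 1 := by rcases hε with rfl | rfl <;> simp
  rw [e2] at this
  simpa using this

end
end TGame

/-! ## Rows, gaps -/

/-- number of elements of `D` in row `y` -/
def rowc {m n : ℕ} [NeZero m] (D : Finset (ZMod m × ZMod n)) (y : ZMod n) : ℕ :=
  (Finset.univ.filter (fun x : ZMod m => (x, y) ∈ D)).card

theorem rowc_full {m n : ℕ} [NeZero m] {D : Finset (ZMod m × ZMod n)} {y : ZMod n}
    (h : ∀ x, (x, y) ∈ D) : rowc D y = m := by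
  unfold rowc
  rw [Finset.filter_true_of_mem (fun x _ => h x), Finset.card_univ, ZMod.card]

theorem rowc_mono {m n : ℕ} [NeZero m] {D D' : Finset (ZMod m × ZMod n)} (h : D ⊆ D')
    (y : ZMod n) : rowc D y ≤ rowc D' y := by
  unfold rowc
  apply Finset.card_le_card
  intro x hx
  simp only [Finset.mem_filter, Finset.mem_univ, true_and] at *
  exact h hx

theorem sum_rowc_le {m n : ℕ} [NeZero m] [NeZero n] (D : Finset (ZMod m × ZMod n))
    (S : Finset (ZMod n)) : ∑ y ∈ S, rowc D y ≤ D.card := by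
  unfold rowc
  rw [← Finset.card_sigma]
  apply Finset.card_le_card_of_injOn (fun p => (p.2, p.1))
  · rintro ⟨y, x⟩ h
    simp at h ⊢
    exact h.2
  · rintro ⟨y, x⟩ _ ⟨y', x'⟩ _ h
    simp at h ⊢
    exact ⟨h.2, h.1⟩

theorem rowc_ge_of_injOn {m n : ℕ} [NeZero m] {D : Finset (ZMod m × ZMod n)} {y : ZMod n}
    {ι : Type} (S : Finset ι) (f : ι → ZMod m) (hf : ∀ i ∈ S, (f i, y) ∈ D)
    (hi : Set.InjOn f S) : S.card ≤ rowc D y := by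
  unfold rowc
  apply Finset.card_le_card_of_injOn f _ hi
  intro i h
  simpa using hf i h

theorem int_inj_small {m : ℕ} {a b : ℤ} (h : ((a : ℤ) : ZMod m) = b) (h1 : a - b < m)
    (h2 : b - a < m) : a = b := by
  by_contra hne
  rcases lt_or_gt_of_ne hne with h3 | h3
  · exact TGame.dvd_small (m := m) (z := b - a) (by push_cast; rw [h]; ring) (by omega) h2
  · exact TGame.dvd_small (m := m) (z := a - b) (by push_cast; rw [h]; ring) (by omega) h1

theorem gap {m : ℕ} [NeZero m] (s : Finset (ZMod m)) (x : ZMod m) (hx : x ∈ s)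
    (hs : s.card + 1 ≤ m) : ∃ i j : ℕ, 1 ≤ i ∧ 1 ≤ j ∧ x - i ∉ s ∧ x + j ∉ s ∧
      i + j ≤ s.card + 1 := by
  classical
  have hex : ∃ z, z ∉ s := by
    by_contra hc
    push Not at hc
    have : s = Finset.univ := Finset.eq_univ_iff_forall.mpr hc
    rw [this, Finset.card_univ, ZMod.card] at hs
    omega
  obtain ⟨z, hz⟩ := hex
  have hI : ∃ i : ℕ, x - i ∉ s := ⟨(x - z).val, by rw [ZMod.natCast_zmod_val]; simpa using hz⟩
  have hJ : ∃ i : ℕ, x + i ∉ s := ⟨(z - x).val, by rw [ZMod.natCast_zmod_val]; simpa using hz⟩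
  have i1 : 1 ≤ Nat.find hI := by
    rw [Nat.one_le_iff_ne_zero]; intro h0
    have := Nat.find_spec hI
    rw [h0] at this; simp at this; exact this hx
  have j1 : 1 ≤ Nat.find hJ := by
    rw [Nat.one_le_iff_ne_zero]; intro h0
    have := Nat.find_spec hJ
    rw [h0] at this; simp at this; exact this hx
  refine ⟨Nat.find hI, Nat.find hJ, i1, j1, Nat.find_spec hI, Nat.find_spec hJ, ?_⟩
  by_contra hc
  push Not at hc
  have : (Finset.range (s.card + 1)).card ≤ s.card := by
    apply Finset.card_le_card_of_injOn
      (fun k : ℕ => x + (((k : ℤ) - (Nat.find hI - 1 : ℤ) : ℤ) : ZMod m))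
    · intro k hk
      simp only [Finset.coe_range, Set.mem_Iio] at hk
      simp only [Finset.mem_coe]
      rcases Nat.lt_or_ge k (Nat.find hI) with h | h
      · have := Nat.find_min hI (m := Nat.find hI - 1 - k) (by omega)
        rw [not_not] at this
        convert this using 1
        have e : ((k : ℤ) - (Nat.find hI - 1 : ℤ)) = -((Nat.find hI - 1 - k : ℕ) : ℤ) := by omega
        rw [e, Int.cast_neg, Int.cast_natCast]; ring
      · have := Nat.find_min hJ (m := k - (Nat.find hI - 1)) (by omega)
        rw [not_not] at this
        convert this using 1
        have e : ((k : ℤ) - (Nat.find hI - 1 : ℤ)) = ((k - (Nat.find hI - 1) : ℕ) : ℤ) := by omega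
        rw [e, Int.cast_natCast]
    · intro k hk l hl h
      simp only [Finset.coe_range, Set.mem_Iio] at hk hl
      have h' := add_left_cancel h
      have := int_inj_small h' (by omega) (by omega)
      omega
  rw [Finset.card_range] at this
  omega

namespace TGame
section
variable {m n : ℕ} [NeZero m] [NeZero n] (G : TGame m n)

theorem inrow (t : G.T) : ∃ t', G.le t t' ∧ (G.pos t').2 = (G.pos t).2 ∧
    (m - 1) / 2 ≤ rowc (G.dam t') (G.pos t).2 := by
  have hm : 0 < m := Nat.pos_of_ne_zero (NeZero.ne m)
  obtain ⟨t1, ⟨l1, r1⟩, mx⟩ := G.exists_max (fun t' => G.le t t' ∧ (G.pos t').2 = (G.pos t).2)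
    ⟨t, G.le_refl t, rfl⟩
  refine ⟨t1, l1, r1, ?_⟩
  by_contra hc
  push Not at hc
  unfold rowc at hc
  obtain ⟨i, j, hi, hj, xi, xj, hij⟩ := gap
    (Finset.univ.filter (fun x : ZMod m => (x, (G.pos t).2) ∈ G.dam t1)) (G.pos t1).1
    (by simp only [Finset.mem_filter, Finset.mem_univ, true_and]; rw [← r1]; exact G.pos_mem t1)
    (by omega)
  simp only [Finset.mem_filter, Finset.mem_univ, true_and] at xi xj
  obtain ⟨a, a0, am, ha⟩ := G.exists_HR 1 (Or.inl rfl) t1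
  have hh0 := G.hh_nonneg t1
  rcases lt_or_ge (2 * (i : ℤ)) a with h | h
  · obtain ⟨t2, l2, p2, _⟩ := G.hrun (ε := -1) (Or.inr rfl) i (G.HR_flip ha) (by omega) (by omega)
    have h3 := mx t2 l2 ⟨G.le_trans l1 l2, by rw [p2]; exact r1⟩
    apply xi
    have := G.pos_mem t2
    rw [h3, p2, r1] at this
    convert this using 2
    push_cast; ring
  · have : 1 ≤ a + G.hh t1 := by
      by_contra h5
      have e : a = 0 := by omega
      exact G.not_both t1 ⟨by omega, by rw [G.gg_of_HR (Or.inl rfl) ha (by omega) (by omega)]; omega⟩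
    obtain ⟨t2, l2, p2, _⟩ := G.hrun (ε := 1) (Or.inl rfl) j ha this (by omega)
    have h3 := mx t2 l2 ⟨G.le_trans l1 l2, by rw [p2]; exact r1⟩
    apply xj
    have := G.pos_mem t2
    rw [h3, p2, r1] at this
    convert this using 2
    push_cast; ring

/-- the vertical step in direction `ε` is blocked by the cop -/
theorem blocked (hn : 4 ≤ n) (hm : 4 ≤ m) {ε : ℤ} (hε : ε = 1 ∨ ε = -1) (t : G.T)
    (h : Near (G.cp t) ((G.pos t).1, (G.pos t).2 + (ε : ZMod n))) :
    ∃ w : ℤ, (w = 1 ∨ w = 2) ∧ G.VR (-ε) t w ∧ G.gg t ≤ 1 ∧ G.hh t = w := by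
  obtain ⟨d, e, hu, hx, hy⟩ := h
  simp only at hx hy
  have hy' : (G.cp t).2 - (G.pos t).2 = ((ε - e : ℤ) : ZMod n) := by
    push_cast; linear_combination -hy
  have hx' : (G.cp t).1 - (G.pos t).1 = ((-d : ℤ) : ZMod m) := by
    push_cast; linear_combination -hx
  have hg : G.gg t ≤ 1 := by
    unfold gg; rw [hx']
    have := cyD_int_le (m := m) (-d)
    have h2 : |-d| ≤ 1 := by
      rcases hu with ⟨rfl, _⟩ | ⟨_, rfl | rfl⟩ <;> simp
    omega
  have hw : ε * (ε - e) = 1 ∨ ε * (ε - e) = 2 := by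
    have hne : ¬ (d = 0 ∧ e = ε) := by
      rintro ⟨rfl, rfl⟩
      apply G.alive t
      apply Prod.ext
      · rw [hx]; simp
      · rw [← sub_eq_zero, hy']; simp
    unfold UStep at hu
    rcases hε with rfl | rfl <;> omega
  have hv : G.VR (-ε) t (ε * (ε - e)) := by
    unfold VR
    rw [hy']; congr 1
    rcases hε with rfl | rfl <;> ring
  refine ⟨_, hw, hv, hg, ?_⟩
  rw [G.hh_of_VR (by omega) hv (by omega) (by omega)]
  omega

theorem upstep (hn : 4 ≤ n) (hm : 4 ≤ m) {ε : ℤ} (hε : ε = 1 ∨ ε = -1) (t : G.T)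
    (h : ¬ ∃ t', G.le t t' ∧ (G.pos t').2 = (G.pos t).2 + (ε : ZMod n)) :
    ∃ w : ℤ, (w = 1 ∨ w = 2) ∧ G.VR (-ε) t w ∧ G.gg t ≤ 1 ∧ G.hh t = w := by
  apply G.blocked hn hm hε
  by_contra hc
  obtain ⟨t', l, p, _⟩ := G.step t _ (⟨0, ε, by unfold UStep; omega, by simp, rfl⟩) hc
  exact h ⟨t', l, by rw [p]⟩

theorem up (hn : 4 ≤ n) (hm : 4 ≤ m) {ε : ℤ} (hε : ε = 1 ∨ ε = -1) (t : G.T) :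
    (∃ t', G.le t t' ∧ (G.pos t').2 = (G.pos t).2 + (ε : ZMod n)) ∨
    (∃ t', G.le t t' ∧ (G.pos t').2 = (G.pos t).2 ∧
      2 * ((m - 1) / 2) ≤ rowc (G.dam t') (G.pos t).2 ∧
      (5 ≤ m → rowc (G.dam t') (G.pos t).2 = m)) := by
  by_cases h : ∃ t', G.le t t' ∧ (G.pos t').2 = (G.pos t).2 + (ε : ZMod n)
  · exact Or.inl h
  right
  have N : ∀ t1, G.le t t1 → (G.pos t1).2 = (G.pos t).2 → G.gg t1 ≤ 1 ∧ 1 ≤ G.hh t1 := by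
    intro t1 l1 r1
    obtain ⟨w, hw, _, h1, h2⟩ := G.upstep hn hm hε t1 (by
      rintro ⟨t', l', r'⟩
      exact h ⟨t', G.le_trans l1 l', by rw [r', r1]⟩)
    omega
  obtain ⟨δ, hδ, hr⟩ := G.exists_HR_min t
  have N0 := N t (G.le_refl t) rfl
  have g0 := G.gg_nonneg t
  rcases Nat.lt_or_ge m 5 with h5 | h5
  · obtain ⟨t', l', p', _⟩ := G.hstep hδ hr (by omega) (by omega)
    refine ⟨t', l', by rw [p'], ?_, by omega⟩
    have hm4 : m = 4 := by omega
    have : ({0, 1} : Finset ℕ).card ≤ rowc (G.dam t') (G.pos t).2 := by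
      apply rowc_ge_of_injOn _ (fun k : ℕ => (G.pos t).1 + ((δ * k : ℤ) : ZMod m))
      · intro i hi
        simp at hi
        rcases hi with rfl | rfl
        · simpa using G.dam_mono l' (G.pos_mem t)
        · have := G.pos_mem t'
          rw [p'] at this; simpa using this
      · intro a ha b hb hab
        simp at ha hb
        have := int_inj_small (add_left_cancel hab)
          (by rcases hδ with rfl | rfl <;> omega) (by rcases hδ with rfl | rfl <;> omega)
        rcases hδ with rfl | rfl <;> omega
    simp at this
    omega
  · obtain ⟨t', l', ⟨lt, rt, _⟩, e, f⟩ := G.lap hδ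
      (fun t1 => G.le t t1 ∧ (G.pos t1).2 = (G.pos t).2 ∧ ∃ a : ℤ, G.HR δ t1 a ∧ 0 ≤ a ∧ a ≤ 1)
      (by
        rintro t1 ⟨l1, r1, a, ha, a0, a1⟩
        have N1 := N t1 l1 r1
        obtain ⟨t2, l2, p2, _, a2, ha2, b2, _⟩ := G.hstep hδ ha (by omega) (by omega)
        have r2 : (G.pos t2).2 = (G.pos t).2 := by rw [p2]; exact r1
        refine ⟨t2, l2, ⟨G.le_trans l1 l2, r2, a2, ha2, ?_⟩, p2⟩
        have N2 := N t2 (G.le_trans l1 l2) r2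
        unfold LBall at b2
        rw [G.gg_of_HR hδ ha2 (by omega) (by omega)] at N2
        omega) t ⟨G.le_refl t, rfl, _, hr, by omega, by omega⟩
    have := rowc_full f
    exact ⟨t', l', e, by omega, fun _ => this⟩

/-- from a nonfull row one can get next to the cop -/
theorem contact (hn : 4 ≤ n) (hm : 4 ≤ m) (t : G.T) :
    (∃ t', G.le t t' ∧ ∀ x, (x, (G.pos t).2) ∈ G.dam t') ∨
    (∃ t', G.le t t' ∧ (G.pos t').2 = (G.pos t).2 ∧
      (G.hh t' = 0 ∨ (G.hh t' = 1 ∧ G.gg t' = 1))) := by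
  by_cases h : ∃ t', G.le t t' ∧ (G.pos t').2 = (G.pos t).2 ∧
      (G.hh t' = 0 ∨ (G.hh t' = 1 ∧ G.gg t' = 1))
  · exact Or.inr h
  left
  push Not at h
  obtain ⟨t', l, _, _, f⟩ := G.lap (ε := 1) (Or.inl rfl)
    (fun t1 => G.le t t1 ∧ (G.pos t1).2 = (G.pos t).2)
    (by
      rintro t1 ⟨l1, r1⟩
      have N := h t1 l1 r1
      have h0 := G.hh_nonneg t1
      obtain ⟨a, a0, am, ha⟩ := G.exists_HR 1 (Or.inl rfl) t1
      have hg := G.gg_of_HR (Or.inl rfl) ha (by omega) (by omega)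
      obtain ⟨t2, l2, p2, _⟩ := G.hstep (Or.inl rfl) ha (by omega) (by
        by_contra hc
        exact N.2 (by omega) (by omega))
      exact ⟨t2, l2, ⟨G.le_trans l1 l2, by rw [p2]; exact r1⟩, p2⟩) t ⟨G.le_refl t, rfl⟩
  exact ⟨t', l, f⟩

theorem touch_run (hn : 4 ≤ n) (hm : 4 ≤ m) (t : G.T)
    (h : G.hh t = 0 ∨ (G.hh t = 1 ∧ G.gg t = 1)) :
    ∃ ε : ℤ, (ε = 1 ∨ ε = -1) ∧ G.VR ε t (G.hh t) ∧ ∀ s : ℕ, s ≤ (n - 1) / 2 →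
      ∃ t', G.le t t' ∧ (G.pos t').2 = (G.pos t).2 + (ε : ZMod n) * s := by
  obtain ⟨ε, hε, hv⟩ := G.exists_VR_min t
  refine ⟨ε, hε, hv, fun s hs => ?_⟩
  have := G.not_both t
  have := G.gg_nonneg t
  obtain ⟨t', l, p⟩ := G.vrun hε s hv (by omega) (by omega)
  exact ⟨t', l, by rw [p]⟩

theorem TF (hn : 4 ≤ n) (hm : 4 ≤ m) (hN : ∀ t, (G.dam t).card < (m - 1) / 2 * n) (t : G.T) :
    ∃ t', G.le t t' ∧ ∃ y0 : ZMod n, ∀ i : ℕ, i < (n - 1) / 2 → ∀ x, (x, y0 + i) ∈ G.dam t' := by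
  classical
  obtain ⟨t1, l1, mx⟩ := G.exists_max (fun t' => G.le t t') ⟨t, G.le_refl t⟩
  have mx' : ∀ t', G.le t1 t' → G.dam t' = G.dam t1 := fun t' l => mx t' l (G.le_trans l1 l)
  set D := G.dam t1 with hD
  refine ⟨t1, l1, ?_⟩
  set R : ZMod n → Prop := fun y => ∃ t', G.le t1 t' ∧ (G.pos t').2 = y with hR
  have Rext : ∀ {t2}, G.le t1 t2 → ∀ {t3}, G.le t2 t3 → R (G.pos t3).2 :=
    fun l2 _ l3 => ⟨_, G.le_trans l2 l3, rfl⟩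
  have RK : ∀ y, R y → (m - 1) / 2 ≤ rowc D y := by
    rintro y ⟨t2, l2, rfl⟩
    obtain ⟨t3, l3, _, h3⟩ := G.inrow t2
    rwa [mx' t3 (G.le_trans l2 l3)] at h3
  have hcard : D.card < (m - 1) / 2 * n := hN t1
  by_cases hall : ∀ y, R y
  · exfalso
    have h1 := sum_rowc_le D Finset.univ
    have h2 : ∑ y : ZMod n, (m - 1) / 2 ≤ ∑ y : ZMod n, rowc D y :=
      Finset.sum_le_sum (fun y _ => RK y (hall y))
    rw [Finset.sum_const, Finset.card_univ, ZMod.card, smul_eq_mul, mul_comm] at h2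
    omega
  push Not at hall
  obtain ⟨z, hz⟩ := hall
  have hk : ∃ k : ℕ, ¬ R ((G.pos t1).2 + k) :=
    ⟨(z - (G.pos t1).2).val, by rw [ZMod.natCast_zmod_val]; simpa using hz⟩
  have R0 : R (G.pos t1).2 := ⟨t1, G.le_refl _, rfl⟩
  have k1 : Nat.find hk ≠ 0 := by
    intro h0
    have := Nat.find_spec hk
    rw [h0] at this; simp at this; exact this R0
  obtain ⟨k, hkk⟩ := Nat.exists_eq_succ_of_ne_zero k1
  have hnk := Nat.find_spec hk
  have hpk := Nat.find_min hk (m := k) (by omega)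
  rw [not_not] at hpk
  rw [hkk] at hnk
  set T := (G.pos t1).2 + (k : ZMod n) with hT
  have hnT : ¬ R (T + 1) := by
    have : T + 1 = (G.pos t1).2 + (k.succ : ZMod n) := by rw [hT]; push_cast; ring
    rw [this]; exact hnk
  have he : ∃ e : ℕ, ¬ R (T - e) := ⟨n - 1, by
    rw [Nat.cast_sub (by omega)]; simpa using hnT⟩
  have heS := Nat.find_spec he
  have heM : ∀ i, i < Nat.find he → R (T - i) := fun i hi => by
    have := Nat.find_min he hi
    rwa [not_not] at this
  have hle : Nat.find he ≤ n - 1 := Nat.find_min' he (by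
    rw [Nat.cast_sub (by omega)]; simpa using hnT)
  set e := Nat.find he with hee
  have he1 : e ≠ 0 := by
    intro h0
    rw [h0] at heS; simp at heS; exact heS hpk
  -- T5
  have heK : (n - 1) / 2 ≤ e := by
    by_contra hc
    push Not at hc
    obtain ⟨t2, l2, r2⟩ := hpk
    obtain ⟨w, hw, hv, _, _⟩ := G.upstep hn hm (ε := 1) (Or.inl rfl) t2 (by
      rintro ⟨t3, l3, r3⟩
      apply hnT
      refine ⟨t3, G.le_trans l2 l3, by rw [r3, r2]; simp⟩)
    have := G.gg_nonneg t2
    obtain ⟨t3, l3, p3⟩ := G.vrun (Or.inr rfl) e hv (by omega) (by omega)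
    apply heS
    refine ⟨t3, G.le_trans l2 l3, by rw [p3, r2]; push_cast; ring⟩
  -- T3
  have hfull : ∀ i : ℕ, i < e → i < (n - 1) / 2 → e ≤ i + (n - 1) / 2 →
      ∀ x, (x, T - i) ∈ D := by
    intro i h1 h2 h3
    obtain ⟨t2, l2, r2⟩ := heM i h1
    rcases G.contact hn hm t2 with ⟨t3, l3, f3⟩ | ⟨t3, l3, r3, c3⟩
    · rw [r2, mx' t3 (G.le_trans l2 l3)] at f3
      exact f3
    · exfalso
      obtain ⟨ε, hε, _, hrun⟩ := G.touch_run hn hm t3 c3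
      rcases hε with rfl | rfl
      · obtain ⟨t4, l4, r4⟩ := hrun (i + 1) (by omega)
        apply hnT
        refine ⟨t4, G.le_trans (G.le_trans l2 l3) l4, ?_⟩
        rw [r4, r3, r2]; push_cast; ring
      · obtain ⟨t4, l4, r4⟩ := hrun (e - i) (by omega)
        apply heS
        refine ⟨t4, G.le_trans (G.le_trans l2 l3) l4, ?_⟩
        rw [r4, r3, r2, Nat.cast_sub (by omega)]; push_cast; ring
  rcases Nat.eq_or_lt_of_le heK with hE | hE
  · refine ⟨T - ((e - 1 : ℕ) : ZMod n), fun i hi x => ?_⟩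
    have := hfull (e - 1 - i) (by omega) (by omega) (by omega) x
    convert this using 2
    rw [Nat.cast_sub (by omega : i ≤ e - 1)]; ring
  · exfalso
    have h0 : 2 * ((m - 1) / 2) ≤ rowc D T := by
      obtain ⟨t2, l2, r2⟩ := hpk
      rcases G.up hn hm (ε := 1) (Or.inl rfl) t2 with ⟨t3, l3, r3⟩ | ⟨t3, l3, _, h3, _⟩
      · exact absurd ⟨t3, G.le_trans l2 l3, by rw [r3, r2]; simp⟩ hnT
      · rwa [mx' t3 (G.le_trans l2 l3), r2] at h3
    have h1 : 2 * ((m - 1) / 2) ≤ rowc D (T - ((e - 1 : ℕ) : ZMod n)) := by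
      obtain ⟨t2, l2, r2⟩ := heM (e - 1) (by omega)
      rcases G.up hn hm (ε := -1) (Or.inr rfl) t2 with ⟨t3, l3, r3⟩ | ⟨t3, l3, _, h3, _⟩
      · refine absurd ⟨t3, G.le_trans l2 l3, ?_⟩ heS
        rw [r3, r2, Nat.cast_sub (by omega)]; push_cast; ring
      · rwa [mx' t3 (G.le_trans l2 l3), r2] at h3
    set good : Finset ℕ := insert 0 (insert (e - 1) (Finset.Ico (e - (n - 1) / 2) ((n - 1) / 2)))
      with hgood
    have hgc : n - e ≤ good.card := by
      rw [hgood, Finset.card_insert_of_notMem, Finset.card_insert_of_notMem, Nat.card_Ico]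
      · omega
      · simp; omega
      · simp; omega
    have hgs : good ⊆ Finset.range e := by
      intro i hi
      simp [hgood] at hi ⊢
      omega
    have hinj : Set.InjOn (fun i : ℕ => T - (i : ZMod n)) (Finset.range e) := by
      intro a ha b hb hab
      simp at ha hb
      have h2 : ((a : ℤ) : ZMod n) = ((b : ℤ) : ZMod n) := by
        have := sub_right_injective hab
        push_cast; exact this
      have := int_inj_small h2 (by omega) (by omega)
      omega
    have hs1 : ∑ i ∈ Finset.range e, rowc D (T - (i : ZMod n)) ≤ D.card := by
      rw [← Finset.sum_image (f := fun y => rowc D y) hinj]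
      exact sum_rowc_le D _
    have hs2 : ∑ i ∈ Finset.range e, ((m - 1) / 2 + if i ∈ good then (m - 1) / 2 else 0) ≤
        ∑ i ∈ Finset.range e, rowc D (T - (i : ZMod n)) := by
      apply Finset.sum_le_sum
      intro i hi
      simp at hi
      split_ifs with hg
      · rw [hgood] at hg
        simp only [Finset.mem_insert, Finset.mem_Ico] at hg
        rcases hg with rfl | rfl | hg
        · simp; omega
        · omega
        · have := rowc_full (hfull i hi (by omega) (by omega))
          omega
      · simpa using RK _ (heM i hi)
    rw [Finset.sum_add_distrib, Finset.sum_const, Finset.card_range, ← Finset.sum_filter,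
      Finset.sum_const, Finset.filter_mem_eq_inter, Finset.inter_eq_right.mpr hgs,
      smul_eq_mul, smul_eq_mul, ← add_mul] at hs2
    have : n * ((m - 1) / 2) ≤ (e + good.card) * ((m - 1) / 2) :=
      Nat.mul_le_mul_right _ (by omega)
    rw [mul_comm n] at this
    omega

/-- window of `K'` consecutive rows -/
def InW (n : ℕ) (y0 y : ZMod n) : Prop := ∃ i : ℕ, i < (n - 1) / 2 ∧ y = y0 + i

theorem InW_excl {y0 y : ZMod n} {k : ℤ} (h1 : InW n y0 y) (h2 : InW n y0 (y + (k : ZMod n)))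
    (h3 : ((n - 1) / 2 : ℕ) ≤ |k|) (h4 : |k| ≤ n - ((n - 1) / 2 : ℕ)) : False := by
  obtain ⟨i, hi, rfl⟩ := h1
  obtain ⟨j, hj, he⟩ := h2
  have : (((i : ℤ) + k : ℤ) : ZMod n) = ((j : ℤ) : ZMod n) := by
    push_cast
    have := he
    rw [add_assoc] at this
    exact add_left_cancel this
  have hk := abs_cases k
  have := int_inj_small this (by omega) (by omega)
  omega

theorem window (hn : 4 ≤ n) (hm : 4 ≤ m) (hN : ∀ t, (G.dam t).card < (m - 1) / 2 * n) (t : G.T) :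
    ∃ y0 : ZMod n, ∀ S : Finset (ZMod n), (∀ y ∈ S, ¬ InW n y0 y) →
      (n - 1) / 2 * m + ∑ y ∈ S, rowc (G.dam t) y < (m - 1) / 2 * n := by
  classical
  obtain ⟨t', l, y0, h⟩ := G.TF hn hm hN t
  refine ⟨y0, fun S hS => ?_⟩
  refine lt_of_le_of_lt ?_ (hN t')
  set W : Finset (ZMod n) := (Finset.range ((n - 1) / 2)).image (fun i : ℕ => y0 + (i : ZMod n))
    with hW
  have hinj : Set.InjOn (fun i : ℕ => y0 + (i : ZMod n)) (Finset.range ((n - 1) / 2)) := by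
    intro a ha b hb hab
    simp at ha hb
    have h2 : ((a : ℤ) : ZMod n) = ((b : ℤ) : ZMod n) := by
      have := add_left_cancel hab
      push_cast; exact this
    have := int_inj_small h2 (by omega) (by omega)
    omega
  have hd : Disjoint W S := by
    rw [Finset.disjoint_left]
    intro y hy hy2
    rw [hW, Finset.mem_image] at hy
    obtain ⟨i, hi, rfl⟩ := hy
    exact hS _ hy2 ⟨i, by simpa using hi, rfl⟩
  have h1 := sum_rowc_le (G.dam t') (W ∪ S)
  rw [Finset.sum_union hd] at h1
  have h2 : ∑ y ∈ W, rowc (G.dam t') y = (n - 1) / 2 * m := by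
    rw [hW, Finset.sum_image hinj, Finset.sum_congr rfl (g := fun _ => m), Finset.sum_const,
      Finset.card_range, smul_eq_mul]
    intro i hi
    exact rowc_full (h i (by simpa using hi))
  have h3 : ∑ y ∈ S, rowc (G.dam t) y ≤ ∑ y ∈ S, rowc (G.dam t') y :=
    Finset.sum_le_sum (fun y _ => rowc_mono (G.dam_mono l) y)
  omega

end
end TGame

/-! ## Phase one -/

theorem Xval {m n X : ℕ} (hm : 4 ≤ m) (hn : 4 ≤ n)
    (hX : (n - 1) / 2 * m + X = (m - 1) / 2 * n) :
    (n % 2 = 0 ∧ m % 2 = 1 ∧ 2 * X + n = 2 * m) ∨ (n % 2 = 0 ∧ m % 2 = 0 ∧ X + n = m) ∨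
    (n % 2 = 1 ∧ m % 2 = 1 ∧ 2 * X + n = m) ∨ (n % 2 = 1 ∧ m % 2 = 0 ∧ 2 * X + 2 * n = m) := by
  obtain ⟨t, ht⟩ : ∃ t, (n - 1) / 2 = t := ⟨_, rfl⟩
  obtain ⟨k, hk⟩ : ∃ k, (m - 1) / 2 = k := ⟨_, rfl⟩
  rw [ht, hk] at hX
  rcases Nat.mod_two_eq_zero_or_one n with h1 | h1 <;>
    rcases Nat.mod_two_eq_zero_or_one m with h2 | h2
  · have e1 : n = 2 * t + 2 := by omega
    have e2 : m = 2 * k + 2 := by omega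
    subst e1 e2
    have : X + 2 * t = 2 * k := by nlinarith
    omega
  · have e1 : n = 2 * t + 2 := by omega
    have e2 : m = 2 * k + 1 := by omega
    subst e1 e2
    have : X + t = 2 * k := by nlinarith
    omega
  · have e1 : n = 2 * t + 1 := by omega
    have e2 : m = 2 * k + 2 := by omega
    subst e1 e2
    have : X + 2 * t = k := by nlinarith
    omega
  · have e1 : n = 2 * t + 1 := by omega
    have e2 : m = 2 * k + 1 := by omega
    subst e1 e2
    have : X + t = k := by nlinarith
    omega

theorem card_le_two_rows {m n : ℕ} [NeZero m] {D : Finset (ZMod m × ZMod n)} {y1 y2 : ZMod n}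
    {ι : Type} (S : Finset ι) (f : ι → ZMod m)
    (hf : ∀ i ∈ S, (f i, y1) ∈ D ∨ (f i, y2) ∈ D)
    (hi : Set.InjOn f S) : S.card ≤ rowc D y1 + rowc D y2 := by
  classical
  rw [← Finset.card_filter_add_card_filter_not (s := S) (fun i => (f i, y1) ∈ D)]
  apply Nat.add_le_add
  · apply rowc_ge_of_injOn _ f
    · intro i h
      exact (Finset.mem_filter.mp h).2
    · exact hi.mono (by intro i h; simp at h; exact h.1)
  · apply rowc_ge_of_injOn _ f
    · intro i h
      have := Finset.mem_filter.mp h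
      exact (hf i this.1).resolve_left this.2
    · exact hi.mono (by intro i h; simp at h; exact h.1)

namespace TGame
section
variable {m n : ℕ} [NeZero m] [NeZero n] (G : TGame m n)

/-- extensions of `t0` in which the cop is at least as far horizontally as vertically -/
def InS (t0 t : G.T) : Prop := G.le t0 t ∧ G.hh t ≤ G.gg t

theorem hh_le_abs {ε : ℤ} (hε : ε = 1 ∨ ε = -1) {t : G.T} {w : ℤ} (h : G.VR ε t w) :
    G.hh t ≤ |w| := by
  unfold hh
  rw [h, cyD_signed _ _ hε]
  exact cyD_int_le w

theorem crun {t0 : G.T} {ε : ℤ} (hε : ε = 1 ∨ ε = -1) (s : ℕ) {t : G.T} {a : ℤ}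
    (hS : G.InS t0 t) (h : G.HR ε t a) (ha : G.hh t ≤ a) (h1 : 1 ≤ a + G.hh t)
    (hb : G.hh t + 2 * s ≤ m - a) (hc : 2 * s + 1 ≤ m - a + G.hh t) :
    ∃ t', G.InS t0 t' ∧ G.pos t' = ((G.pos t).1 + (ε : ZMod m) * s, (G.pos t).2) ∧
      min a (m - a - 2 * s) ≤ G.gg t' := by
  obtain ⟨t', l, p, a', r', b'⟩ := G.hrun hε s h h1 hc
  unfold LBall at b'
  have h0 := G.hh_nonneg t
  have h0' := G.hh_nonneg t'
  have := G.gg_of_HR hε r' (by omega) (by omega)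
  exact ⟨t', ⟨G.le_trans hS.1 l, by omega⟩, p, by omega⟩

theorem colrun {t0 t : G.T} {a k : ℤ} (hS : G.InS t0 t) (h : G.HR 1 t a) (hk : G.hh t ≤ k)
    (k1 : 1 ≤ k) (ka : k ≤ a) (kb : k ≤ m - a) (i : ℤ) (hi : 2 * i ≤ m - a - k)
    (hi' : -(2 * i) ≤ a - k) :
    ∃ t', G.InS t0 t' ∧ G.pos t' = ((G.pos t).1 + (i : ZMod m), (G.pos t).2) ∧ k ≤ G.gg t' := by
  have h0 := G.hh_nonneg t
  rcases le_total 0 i with h2 | h2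
  · obtain ⟨s, rfl⟩ := Int.eq_ofNat_of_zero_le h2
    obtain ⟨t', S', p', g'⟩ := G.crun (Or.inl rfl) s hS h (by omega) (by omega) (by omega) (by omega)
    exact ⟨t', S', by rw [p']; simp, by omega⟩
  · obtain ⟨s, hs⟩ := Int.eq_ofNat_of_zero_le (neg_nonneg.mpr h2)
    have e : i = -(s : ℤ) := by omega
    subst e
    obtain ⟨t', S', p', g'⟩ := G.crun (Or.inr rfl) s hS (G.HR_flip h) (by omega) (by omega)
      (by omega) (by omega)
    exact ⟨t', S', by rw [p']; simp, by omega⟩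

theorem col_inj {a k : ℤ} (x : ZMod m) (k1 : 1 ≤ k) :
    Set.InjOn (fun i : ℤ => x + (i : ZMod m))
      (Finset.Icc (-((a - k) / 2)) ((m - a - k) / 2) : Finset ℤ) := by
  intro i hi j hj h
  simp at hi hj
  exact int_inj_small (add_left_cancel h) (by omega) (by omega)

theorem colcount {t0 t : G.T} (hmax : ∀ t, G.InS t0 t → G.dam t = G.dam t0)
    {a k : ℤ} (hS : G.InS t0 t) (h : G.HR 1 t a) (hk : G.hh t ≤ k)
    (k1 : 1 ≤ k) (ka : k ≤ a) (kb : k ≤ m - a) :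
    1 + (a - k) / 2 + (m - a - k) / 2 ≤ rowc (G.dam t0) (G.pos t).2 := by
  have := rowc_ge_of_injOn (D := G.dam t0) (y := (G.pos t).2)
    (Finset.Icc (-((a - k) / 2)) ((m - a - k) / 2)) (fun i : ℤ => (G.pos t).1 + (i : ZMod m))
    (by
      intro i hi
      simp at hi
      obtain ⟨t', S', p', _⟩ := G.colrun hS h hk k1 ka kb i (by omega) (by omega)
      have := G.pos_mem t'
      rwa [hmax t' S', p'] at this) (col_inj _ k1)
  rw [Int.card_Icc] at this
  omega

theorem rowK {t0 t : G.T} (hmax : ∀ t, G.InS t0 t → G.dam t = G.dam t0)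
    (hS : G.InS t0 t) (hk : G.hh t ≤ 1) : (m - 1) / 2 ≤ rowc (G.dam t0) (G.pos t).2 := by
  obtain ⟨a, a0, am, ha⟩ := G.exists_HR 1 (Or.inl rfl) t
  have hg := G.gg_of_HR (Or.inl rfl) ha (by omega) (by omega)
  have := G.not_both t
  have := hS.2
  have := G.hh_nonneg t
  have := G.colcount hmax hS ha hk le_rfl (by omega) (by omega)
  omega

theorem nbr_toward {t0 t : G.T} (hmax : ∀ t, G.InS t0 t → G.dam t = G.dam t0)
    (hS : G.InS t0 t) (hg : 2 ≤ G.gg t) (h1 : 1 ≤ G.hh t) {ε : ℤ} (hε : ε = 1 ∨ ε = -1)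
    (hv : G.VR ε t (G.hh t)) :
    ((G.pos t).1, (G.pos t).2 + ((-ε : ℤ) : ZMod n)) ∈ G.dam t0 := by
  have hn2 : 2 * G.hh t ≤ n := cyD_le_half _
  have hε' : -ε = 1 ∨ -ε = -1 := by omega
  obtain ⟨t', l, p, w', v', b', _⟩ := G.vstep hε' (G.VR_flip hv) (by omega) (by omega)
  unfold LBall at b'
  have h2 := G.hh_le_abs (by omega) (G.VR_flip v')
  have h3 := abs_cases ((n : ℤ) - w')
  have h4 := hS.2
  have S' : G.InS t0 t' := ⟨G.le_trans hS.1 l, by omega⟩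
  have := G.pos_mem t'
  rwa [hmax t' S', p] at this

theorem nbr {t0 t : G.T} (hn : 4 ≤ n) (hmax : ∀ t, G.InS t0 t → G.dam t = G.dam t0)
    (hS : G.InS t0 t) (hg : 2 ≤ G.gg t) :
    ((G.pos t).1, (G.pos t).2 + 1) ∈ G.dam t0 ∨ ((G.pos t).1, (G.pos t).2 - 1) ∈ G.dam t0 := by
  obtain ⟨ε, hε, hv⟩ := G.exists_VR_min t
  have h0 := G.hh_nonneg t
  rcases eq_or_lt_of_le h0 with h | h
  · rw [← h] at hv
    obtain ⟨t', l, p, w', v', b', _⟩ := G.vstep hε hv (by omega) (by omega)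
    unfold LBall at b'
    have h2 := G.hh_le_abs hε v'
    have h3 := abs_cases w'
    have S' : G.InS t0 t' := ⟨G.le_trans hS.1 l, by omega⟩
    have := G.pos_mem t'
    rw [hmax t' S', p] at this
    rcases hε with rfl | rfl
    · left; simpa using this
    · right; simpa [sub_eq_add_neg] using this
  · have := G.nbr_toward hmax hS hg (by omega) hε hv
    rcases hε with rfl | rfl
    · right; simpa [sub_eq_add_neg] using this
    · left; simpa using this

theorem nbrcount {t0 t : G.T} (hn : 4 ≤ n) (hmax : ∀ t, G.InS t0 t → G.dam t = G.dam t0)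
    (hS : G.InS t0 t) (hg : 2 ≤ G.gg t) (hk : G.hh t ≤ 1) :
    (m - 1) / 2 - 1 ≤ rowc (G.dam t0) ((G.pos t).2 + 1) + rowc (G.dam t0) ((G.pos t).2 - 1) := by
  obtain ⟨a, a0, am, ha⟩ := G.exists_HR 1 (Or.inl rfl) t
  have hg' := G.gg_of_HR (Or.inl rfl) ha (by omega) (by omega)
  have := card_le_two_rows (D := G.dam t0) (y1 := (G.pos t).2 + 1) (y2 := (G.pos t).2 - 1)
    (Finset.Icc (-((a - 2) / 2)) ((m - a - 2) / 2)) (fun i : ℤ => (G.pos t).1 + (i : ZMod m))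
    (by
      intro i hi
      simp at hi
      obtain ⟨t', S', p', g'⟩ := G.colrun (k := 2) hS ha (by omega) (by omega) (by omega)
        (by omega) i (by omega) (by omega)
      have := G.nbr hn hmax S' g'
      rwa [p'] at this) (col_inj _ (by omega))
  rw [Int.card_Icc] at this
  omega

/-- moving vertically toward the cop -/
theorem chase {t0 t : G.T} (hS : G.InS t0 t) (h2 : 2 ≤ G.hh t) {ε : ℤ} (hε : ε = 1 ∨ ε = -1)
    (hv : G.VR ε t (n - G.hh t)) {a : ℤ} (ha : G.HR 1 t a) :
    ∃ t', G.InS t0 t' ∧ G.gg t - G.hh t ≤ G.gg t' - G.hh t' ∧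
      (G.hh t' < G.hh t ∨ (G.hh t' = G.hh t ∧ G.VR ε t' (n - G.hh t) ∧ G.HR 1 t' a ∧
        G.pos t' = ((G.pos t).1, (G.pos t).2 + (ε : ZMod n)))) := by
  have hn2 : 2 * G.hh t ≤ n := cyD_le_half _
  have hS2 := hS.2
  obtain ⟨t', l, p, w', v', b', c'⟩ := G.vstep hε hv (by omega) (by omega)
  unfold LBall at b'
  have h3 := G.hh_le_abs (by omega) (G.VR_flip v')
  have h4 := abs_cases ((n : ℤ) - w')
  refine ⟨t', ⟨G.le_trans hS.1 l, by omega⟩, by omega, ?_⟩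
  rcases lt_or_ge (G.hh t') (G.hh t) with h | h
  · exact Or.inl h
  · right
    have e : w' = n - G.hh t := by omega
    refine ⟨by omega, e ▸ v', ?_, p⟩
    have c2 : (G.cp t').1 = (G.cp t).1 := c'.resolve_left (by omega)
    unfold HR at *
    rw [c2, p]; exact ha

theorem drift {t0 : G.T} (hn : 4 ≤ n) (hm : 4 ≤ m)
    (hmax : ∀ t, G.InS t0 t → G.dam t = G.dam t0)
    {X : ℕ} (hX : (n - 1) / 2 * m + X = (m - 1) / 2 * n)
    (hW : ∃ y0 : ZMod n, ∀ S : Finset (ZMod n), (∀ y ∈ S, ¬ InW n y0 y) →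
      ∑ y ∈ S, rowc (G.dam t0) y < X) (c : ℤ) (hc : 0 ≤ c)  (k : ℕ) : ∀ t : G.T,
    G.InS t0 t → G.hh t + c ≤ G.gg t → G.hh t ≤ k → ∃ t', G.InS t0 t' ∧
      G.hh t' + c ≤ G.gg t' ∧ G.hh t' ≤ 1 := by
  classical
  induction k with
  | zero => exact fun t h1 h2 h3 => ⟨t, h1, h2, by push_cast at h3; omega⟩
  | succ k ih =>
    intro t hS hcg hk
    by_contra hno
    have h2 : 2 ≤ G.hh t := by
      by_contra h; exact hno ⟨t, hS, hcg, by omega⟩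
    obtain ⟨ε', hε', hv'⟩ := G.exists_VR_min t
    obtain ⟨ε, hε, hv⟩ : ∃ ε : ℤ, (ε = 1 ∨ ε = -1) ∧ G.VR ε t (n - G.hh t) :=
      ⟨-ε', by omega, G.VR_flip hv'⟩
    obtain ⟨a, a0, am, ha⟩ := G.exists_HR 1 (Or.inl rfl) t
    have hg := G.gg_of_HR (Or.inl rfl) ha (by omega) (by omega)
    have hS2 := hS.2
    have key : ∀ j : ℕ, ∃ t', G.InS t0 t' ∧ G.hh t' = G.hh t ∧ G.VR ε t' (n - G.hh t) ∧
        G.HR 1 t' a ∧ G.pos t' = ((G.pos t).1, (G.pos t).2 + (ε : ZMod n) * j) := by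
      intro j
      induction j with
      | zero => exact ⟨t, hS, rfl, hv, ha, by simp⟩
      | succ j ihj =>
        obtain ⟨t1, S1, e1, v1, r1, p1⟩ := ihj
        have hg1 := G.gg_of_HR (Or.inl rfl) r1 (by omega) (by omega)
        rw [← e1] at v1
        obtain ⟨t2, S2, g2, h2⟩ := G.chase S1 (by omega) hε v1 r1
        rcases h2 with h2 | ⟨e2, v2, r2, p2⟩
        · exact absurd (ih t2 S2 (by omega) (by omega)) hno
        · refine ⟨t2, S2, by omega, e1 ▸ v2, r2, ?_⟩
          rw [p2, p1]; push_cast; ext <;> simp; ring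
    have hrow : ∀ y : ZMod n, 1 + (a - G.hh t) / 2 + (m - a - G.hh t) / 2 ≤
        rowc (G.dam t0) y := by
      intro y
      obtain ⟨t1, S1, e1, v1, r1, p1⟩ := key ((ε : ZMod n) * (y - (G.pos t).2)).val
      have := G.colcount hmax S1 r1 (k := G.hh t) (by omega) (by omega) (by omega) (by omega)
      rw [p1, ZMod.natCast_zmod_val, ← mul_assoc] at this
      have e2 : (ε : ZMod n) * ε = 1 := by rcases hε with rfl | rfl <;> simp
      rw [e2] at this
      simpa using this
    obtain ⟨f, hf⟩ : ∃ f : ℕ, (f : ℤ) = 1 + (a - G.hh t) / 2 + (m - a - G.hh t) / 2 :=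
      ⟨(1 + (a - G.hh t) / 2 + (m - a - G.hh t) / 2).toNat, by omega⟩
    obtain ⟨y0, hy0⟩ := hW
    have h5 := hy0 (Finset.univ.filter (fun y => ¬ InW n y0 y)) (by simp)
    have h6 : ∑ y ∈ Finset.univ.filter (fun y => ¬ InW n y0 y), f ≤
        ∑ y ∈ Finset.univ.filter (fun y => ¬ InW n y0 y), rowc (G.dam t0) y :=
      Finset.sum_le_sum (fun y _ => by have := hrow y; omega)
    rw [Finset.sum_const, smul_eq_mul] at h6
    have h7 : n - (n - 1) / 2 ≤ (Finset.univ.filter (fun y => ¬ InW n y0 y)).card := by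
      have e1 := Finset.card_filter_add_card_filter_not (s := (Finset.univ : Finset (ZMod n)))
        (fun y => InW n y0 y)
      rw [Finset.card_univ, ZMod.card] at e1
      have e2 : (Finset.univ.filter (fun y => InW n y0 y)).card ≤ (n - 1) / 2 := by
        have : Finset.univ.filter (fun y => InW n y0 y) ⊆
            (Finset.range ((n - 1) / 2)).image (fun i : ℕ => y0 + (i : ZMod n)) := by
          intro y hy
          obtain ⟨i, hi, rfl⟩ := (Finset.mem_filter.mp hy).2
          exact Finset.mem_image_of_mem _ (by simpa using hi)
        exact (Finset.card_le_card this).trans (Finset.card_image_le.trans (by simp))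
      omega
    have h8 : (n - (n - 1) / 2) * f < X := lt_of_le_of_lt
      ((Nat.mul_le_mul_right f h7).trans h6) h5
    have hn2 : 2 * G.hh t ≤ n := cyD_le_half _
    have hf1 : 1 ≤ f := by omega
    have hf2 : m ≤ 2 * f + n := by omega
    have hx := Xval hm hn hX
    obtain ⟨q, hq⟩ : ∃ q, n - (n - 1) / 2 = q := ⟨_, rfl⟩
    rw [hq] at h8
    have h9 : f ≤ q * f := Nat.le_mul_of_pos_left f (by omega)
    rcases Nat.lt_or_ge 1 f with h10 | h10
    · have : q + 2 * f ≤ q * f + 2 := by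
        obtain ⟨f', rfl⟩ : ∃ f', f = f' + 2 := ⟨f - 2, by omega⟩
        have hq2 : 2 ≤ q := by omega
        have : 2 * f' ≤ q * f' := Nat.mul_le_mul_right _ (by omega)
        nlinarith
      omega
    · have : f = 1 := by omega
      subst this
      omega

end
end TGame

namespace TGame
section
variable {m n : ℕ} [NeZero m] [NeZero n] (G : TGame m n)

theorem win1 {R : ZMod n → ℕ} {X : ℕ} {y0 : ZMod n}
    (hy : ∀ S : Finset (ZMod n), (∀ y ∈ S, ¬ InW n y0 y) → ∑ y ∈ S, R y < X)
    {y : ZMod n} (h : ¬ InW n y0 y) : R y < X := by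
  have := hy {y} (by simpa using h)
  simpa using this

theorem win2 {R : ZMod n → ℕ} {X : ℕ} {y0 : ZMod n}
    (hy : ∀ S : Finset (ZMod n), (∀ y ∈ S, ¬ InW n y0 y) → ∑ y ∈ S, R y < X)
    {y z : ZMod n} (hne : y ≠ z) (h : ¬ InW n y0 y) (h' : ¬ InW n y0 z) : R y + R z < X := by
  classical
  have := hy {y, z} (by
    intro u hu
    simp at hu
    rcases hu with rfl | rfl <;> assumption)
  rwa [Finset.sum_pair hne] at this

theorem win3 {R : ZMod n → ℕ} {X : ℕ} {y0 : ZMod n}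
    (hy : ∀ S : Finset (ZMod n), (∀ y ∈ S, ¬ InW n y0 y) → ∑ y ∈ S, R y < X)
    {y z u : ZMod n} (hne : y ≠ z) (hne2 : y ≠ u) (hne3 : z ≠ u)
    (h : ¬ InW n y0 y) (h' : ¬ InW n y0 z) (h'' : ¬ InW n y0 u) : R y + (R z + R u) < X := by
  classical
  have := hy {y, z, u} (by
    intro u hu
    simp at hu
    rcases hu with rfl | rfl | rfl <;> assumption)
  rwa [Finset.sum_insert (by simp [hne, hne2]), Finset.sum_pair hne3] at this

theorem ne_shift {y : ZMod n} {k l : ℤ} (h : k ≠ l) (h1 : k - l < n) (h2 : l - k < n) :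
    y + (k : ZMod n) ≠ y + (l : ZMod n) := fun he =>
  h (int_inj_small (add_left_cancel he) h1 h2)

theorem start (hm : 4 ≤ m) : ∃ t, G.hh t ≤ G.gg t := by
  obtain ⟨c, hc⟩ := G.init
  obtain ⟨t, p, d, e, hu, hx, hy⟩ := hc (c.1 + 2, c.2) (by
    rintro ⟨d, e, hu, hx, hy⟩
    have : ((2 : ℤ) : ZMod m) = (d : ZMod m) := by push_cast; exact add_left_cancel hx
    have := int_inj_small this (by unfold UStep at hu; omega) (by unfold UStep at hu; omega)
    unfold UStep at hu
    omega)
  refine ⟨t, ?_⟩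
  have hr : G.HR 1 t (2 - d) := by
    unfold HR; rw [p, hx]; push_cast; ring
  have hv : G.VR (-1) t e := by
    unfold VR; rw [p, hy]; push_cast; ring
  have h1 := G.hh_le_abs (Or.inr rfl) hv
  have h2 := abs_cases e
  unfold UStep at hu
  rw [G.gg_of_HR (Or.inl rfl) hr (by omega) (by omega)]
  omega

/-- first final case -/
theorem finalI {t0 Z : G.T} (hn : 4 ≤ n) (hm : 5 ≤ m)
    (hmax : ∀ t, G.InS t0 t → G.dam t = G.dam t0)
    {X : ℕ} (hn2 : n % 2 = 0) (hXm : X ≤ m) (hXK : X + 1 ≤ 2 * ((m - 1) / 2))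
    (hW : ∀ t, ∃ y0 : ZMod n, ∀ S : Finset (ZMod n), (∀ y ∈ S, ¬ InW n y0 y) →
      ∑ y ∈ S, rowc (G.dam t) y < X)
    (hZ : G.InS t0 Z) (hZ1 : G.hh Z ≤ 1) (hZ2 : G.hh Z = 0 ∨ 2 ≤ G.gg Z)
    (H : rowc (G.dam t0) (G.pos Z).2 = m ∨ (m - 1) / 2 - 1 ≤
      rowc (G.dam t0) ((G.pos Z).2 + 1) + rowc (G.dam t0) ((G.pos Z).2 - 1)) : False := by
  have hrow := G.rowK hmax hZ hZ1
  obtain ⟨ε, hε, hv⟩ := G.exists_VR_min Z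
  have h1 := G.not_both Z
  have h2 := G.gg_nonneg Z
  have h3 := G.hh_nonneg Z
  obtain ⟨y, hy⟩ : ∃ y, y = (G.pos Z).2 := ⟨_, rfl⟩
  rw [← hy] at hrow H
  obtain ⟨N, hN⟩ : ∃ N : ℕ, n = 2 * N := ⟨n / 2, by omega⟩
  obtain ⟨t1, l1, p1⟩ := G.vrun hε N hv (by omega) (by omega)
  have hq : (G.pos t1).2 = y + ((N : ℤ) : ZMod n) := by
    rw [p1, ← hy]
    rcases hε with rfl | rfl
    · simp
    · have : ((2 * N : ℕ) : ZMod n) = 0 := by rw [← hN]; exact ZMod.natCast_self n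
      push_cast at this
      push_cast
      linear_combination -this
  obtain ⟨t2, l2, r2, k2⟩ := G.inrow t1
  rw [hq] at r2 k2
  have hl : ∀ t', G.le t2 t' → ∀ y, rowc (G.dam t0) y ≤ rowc (G.dam t') y := fun t' l' y =>
    rowc_mono (G.dam_mono (G.le_trans hZ.1 (G.le_trans l1 (G.le_trans l2 l')))) y
  have ab := abs_of_nonneg (Int.natCast_nonneg N)
  have fin : ∀ t', G.le t2 t' →
      (rowc (G.dam t') (y + ((N : ℤ) : ZMod n)) = m ∨
        (m - 1) / 2 ≤ rowc (G.dam t') (y + ((N + 1 : ℤ) : ZMod n))) → False := by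
    intro t' l' hor
    obtain ⟨y0, hy0⟩ := hW t'
    have a1 := hl t' l' y
    have a2 := hl t' l' (y + 1)
    have a3 := hl t' l' (y - 1)
    have a4 := rowc_mono (G.dam_mono l') (y + ((N : ℤ) : ZMod n))
    by_cases c1 : InW n y0 y
    · have n1 : ¬ InW n y0 (y + ((N : ℤ) : ZMod n)) := fun h =>
        InW_excl c1 h (by omega) (by omega)
      have n2 : ¬ InW n y0 (y + ((N + 1 : ℤ) : ZMod n)) := fun h => by
        have := abs_of_nonneg (show (0 : ℤ) ≤ N + 1 by omega)
        exact InW_excl c1 h (by omega) (by omega)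
      rcases hor with hor | hor
      · have := win1 hy0 n1
        omega
      · have := win2 hy0 (ne_shift (by omega) (by omega) (by omega)) n1 n2
        omega
    · by_cases c2 : InW n y0 (y + ((N : ℤ) : ZMod n))
      · have e1 : ((2 * N : ℕ) : ZMod n) = 0 := by rw [← hN]; exact ZMod.natCast_self n
        push_cast at e1
        have n2 : ¬ InW n y0 (y + 1) := fun h => by
          have := abs_of_nonneg (show (0 : ℤ) ≤ N + 1 by omega)
          refine InW_excl (k := N + 1) c2 ?_ (by omega) (by omega)
          convert h using 1
          push_cast; linear_combination e1
        have n3 : ¬ InW n y0 (y - 1) := fun h => by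
          have := abs_of_nonneg (show (0 : ℤ) ≤ N - 1 by omega)
          refine InW_excl (k := N - 1) c2 ?_ (by omega) (by omega)
          convert h using 1
          push_cast; linear_combination e1
        rcases H with H | H
        · have := win1 hy0 c1
          omega
        · have s0 : y = y + ((0 : ℤ) : ZMod n) := by simp
          have s1 : y + 1 = y + ((1 : ℤ) : ZMod n) := by simp
          have s2 : y - 1 = y + ((-1 : ℤ) : ZMod n) := by push_cast; ring
          have d1 : y ≠ y + 1 := by
            rw [s1]; conv_lhs => rw [s0]
            exact ne_shift (by omega) (by omega) (by omega)
          have d2 : y ≠ y - 1 := by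
            rw [s2]; conv_lhs => rw [s0]
            exact ne_shift (by omega) (by omega) (by omega)
          have d3 : y + 1 ≠ y - 1 := by
            rw [s2, s1]
            exact ne_shift (by omega) (by omega) (by omega)
          have := win3 hy0 d1 d2 d3 c1 n2 n3
          omega
      · have d1 : y + ((0 : ℤ) : ZMod n) ≠ y + ((N : ℤ) : ZMod n) :=
          ne_shift (by omega) (by omega) (by omega)
        rw [Int.cast_zero, add_zero] at d1
        have := win2 hy0 d1 c1 c2
        omega
  rcases G.up hn (by omega) (ε := 1) (Or.inl rfl) t2 with ⟨t3, l3, r3⟩ | ⟨t3, l3, _, _, f3⟩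
  · obtain ⟨t4, l4, r4, k4⟩ := G.inrow t3
    apply fin t4 (G.le_trans l3 l4)
    right
    rw [r3, r2] at k4
    convert k4 using 2
    push_cast; ring
  · apply fin t3 l3
    left
    rw [← r2]; exact f3 hm

/-- second final case -/
theorem finalII {t0 Z : G.T} (hn : 4 ≤ n) (hm : 5 ≤ m)
    (hmax : ∀ t, G.InS t0 t → G.dam t = G.dam t0)
    {X : ℕ} (hn2 : n % 2 = 0) (hXm : X ≤ m) (hXK : X + 1 ≤ 2 * ((m - 1) / 2))
    (hW : ∀ t, ∃ y0 : ZMod n, ∀ S : Finset (ZMod n), (∀ y ∈ S, ¬ InW n y0 y) →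
      ∑ y ∈ S, rowc (G.dam t) y < X)
    (hZ : G.InS t0 Z) (hZ1 : G.hh Z = 1) {ε : ℤ} (hε : ε = 1 ∨ ε = -1) (hv : G.VR ε Z 1)
    (H : rowc (G.dam t0) (G.pos Z).2 = m ∨ (X ≤ (m - 1) / 2 + 1 ∧
      1 ≤ rowc (G.dam t0) ((G.pos Z).2 + ((-ε : ℤ) : ZMod n)))) : False := by
  have hrow := G.rowK hmax hZ (by omega)
  have h2 := hZ.2
  obtain ⟨y, hy⟩ : ∃ y, y = (G.pos Z).2 := ⟨_, rfl⟩
  rw [← hy] at hrow H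
  obtain ⟨N, hN⟩ : ∃ N : ℕ, n = 2 * N + 2 := ⟨n / 2 - 1, by omega⟩
  obtain ⟨t1, l1, p1⟩ := G.vrun hε N hv (by omega) (by omega)
  have hq : (G.pos t1).2 = y + ((ε * N : ℤ) : ZMod n) := by
    rw [p1, ← hy]; push_cast; ring
  obtain ⟨t2, l2, r2, k2⟩ := G.inrow t1
  rw [hq] at r2 k2
  have hl : ∀ t', G.le t2 t' → ∀ y, rowc (G.dam t0) y ≤ rowc (G.dam t') y := fun t' l' y =>
    rowc_mono (G.dam_mono (G.le_trans hZ.1 (G.le_trans l1 (G.le_trans l2 l')))) y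
  have A : ∀ k : ℤ, 0 ≤ k → |ε * k| = k ∧ |-(ε * k)| = k := by
    intro k hk
    rw [abs_neg, abs_mul, abs_of_nonneg hk]
    rcases hε with rfl | rfl <;> simp
  have A1 := A N (by omega)
  have A2 := A (N + 1) (by omega)
  have A3 := A (N + 2) (by omega)
  have hEN : ε * N = N ∨ ε * N = -N := by rcases hε with rfl | rfl <;> simp
  have exc : ∀ {y0 y z : ZMod n} {k : ℤ}, InW n y0 y → z = y + (k : ZMod n) →
      ((n - 1) / 2 : ℕ) ≤ |k| → |k| ≤ n - ((n - 1) / 2 : ℕ) → ¬ InW n y0 z := by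
    rintro y0 y z k h1 rfl h3 h4 h5
    exact InW_excl h1 h5 h3 h4
  have dne : y ≠ y + ((-ε : ℤ) : ZMod n) := by
    have : y + ((0 : ℤ) : ZMod n) ≠ y + ((-ε : ℤ) : ZMod n) :=
      ne_shift (by omega) (by omega) (by omega)
    simpa using this
  rcases G.up hn (by omega) hε t2 with ⟨t3, l3, r3⟩ | ⟨t3, l3, _, _, f3⟩
  · obtain ⟨t4, l4, r4, k4⟩ := G.inrow t3
    have l' := G.le_trans l3 l4
    have hq4 : (G.pos t3).2 = y + ((ε * (N + 1) : ℤ) : ZMod n) := by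
      rw [r3, r2]; push_cast; ring
    rw [hq4] at k4
    obtain ⟨y0, hy0⟩ := hW t4
    have a1 := hl t4 l' y
    have a2 := hl t4 l' (y + ((-ε : ℤ) : ZMod n))
    have a4 := rowc_mono (G.dam_mono l') (y + ((ε * N : ℤ) : ZMod n))
    by_cases c1 : InW n y0 y
    · have n1 := exc c1 (z := y + ((ε * N : ℤ) : ZMod n)) rfl (by omega) (by omega)
      have n2 := exc c1 (z := y + ((ε * (N + 1) : ℤ) : ZMod n)) rfl (by omega) (by omega)
      have := win2 hy0 (ne_shift (by rcases hε with rfl | rfl <;> omega)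
        (by rcases hε with rfl | rfl <;> omega) (by rcases hε with rfl | rfl <;> omega)) n1 n2
      omega
    · rcases H with H | ⟨H1, H⟩
      · have := win1 hy0 c1
        omega
      · by_cases c2 : InW n y0 (y + ((ε * (N + 1) : ℤ) : ZMod n))
        · have n1 := exc (k := -(ε * (N + 2))) c2 (z := y + ((-ε : ℤ) : ZMod n))
            (by push_cast; ring) (by omega) (by omega)
          have := win2 hy0 dne c1 n1
          omega
        · have : y + ((0 : ℤ) : ZMod n) ≠ y + ((ε * (N + 1) : ℤ) : ZMod n) :=
            ne_shift (by rcases hε with rfl | rfl <;> omega)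
              (by rcases hε with rfl | rfl <;> omega) (by rcases hε with rfl | rfl <;> omega)
          rw [Int.cast_zero, add_zero] at this
          have := win2 hy0 this c1 c2
          omega
  · have f := f3 hm
    rw [r2] at f
    obtain ⟨y0, hy0⟩ := hW t3
    have a1 := hl t3 l3 y
    have a2 := hl t3 l3 (y + ((-ε : ℤ) : ZMod n))
    by_cases c1 : InW n y0 (y + ((ε * N : ℤ) : ZMod n))
    · have n1 := exc (k := -(ε * N)) c1 (z := y) (by push_cast; ring) (by omega) (by omega)
      have n2 := exc (k := -(ε * (N + 1))) c1 (z := y + ((-ε : ℤ) : ZMod n))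
            (by push_cast; ring) (by omega) (by omega)
      have := win2 hy0 dne n1 n2
      have := win1 hy0 n1
      omega
    · have := win1 hy0 c1
      omega

theorem main (hm : 4 ≤ m) (hn : 4 ≤ n) : ∃ t, (m - 1) / 2 * n ≤ (G.dam t).card := by
  by_contra hno
  push Not at hno
  obtain ⟨ts, hs⟩ := G.start hm
  have hlt : (n - 1) / 2 * m < (m - 1) / 2 * n := by
    obtain ⟨y0, h⟩ := G.window hn hm hno ts
    have := h ∅ (by simp)
    omega
  obtain ⟨X, hX⟩ := Nat.exists_eq_add_of_lt hlt
  obtain ⟨X, hX, hX0⟩ : ∃ X : ℕ, (n - 1) / 2 * m + X = (m - 1) / 2 * n ∧ 1 ≤ X :=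
    ⟨X + 1, by omega, by omega⟩
  have hW : ∀ t, ∃ y0 : ZMod n, ∀ S : Finset (ZMod n), (∀ y ∈ S, ¬ InW n y0 y) →
      ∑ y ∈ S, rowc (G.dam t) y < X := by
    intro t
    obtain ⟨y0, h⟩ := G.window hn hm hno t
    exact ⟨y0, fun S hS => by have := h S hS; omega⟩
  have hx := Xval hm hn hX
  have hm5 : 5 ≤ m := by omega
  obtain ⟨t0, ht0, hmax0⟩ := G.exists_max (fun t => G.hh t ≤ G.gg t) ⟨ts, hs⟩
  have hmax : ∀ t, G.InS t0 t → G.dam t = G.dam t0 := fun t h => hmax0 t h.1 h.2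
  have hS0 : G.InS t0 t0 := ⟨G.le_refl _, ht0⟩
  have drift' : ∀ c : ℤ, 0 ≤ c → ∀ t, G.InS t0 t → G.hh t + c ≤ G.gg t →
      ∃ t', G.InS t0 t' ∧ G.hh t' + c ≤ G.gg t' ∧ G.hh t' ≤ 1 := fun c hc t h1 h2 =>
    G.drift hn hm hmax hX (hW t0) c hc (G.hh t).toNat t h1 h2 (by omega)
  obtain ⟨Z, hZ, _, hZ1⟩ := drift' 0 (by omega) t0 hS0 (by simpa using ht0)
  have hZg := hZ.2
  have hZ0 := G.hh_nonneg Z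
  have hZb := G.not_both Z
  rcases Nat.lt_or_ge ((m - 1) / 2) X with hbig | hsmall
  · -- large excess
    by_cases hi : ∃ Z, G.InS t0 Z ∧ G.hh Z ≤ 1 ∧ 2 ≤ G.gg Z
    · obtain ⟨Z, hZ, h1, h2⟩ := hi
      exact G.finalI hn hm5 hmax (by omega) (by omega) (by omega) hW hZ h1 (Or.inr h2)
        (Or.inr (G.nbrcount hn hmax hZ h2 h1))
    push Not at hi
    have hgZ := hi Z hZ hZ1
    obtain ⟨ε, hε, hr⟩ := G.exists_HR_min Z
    have hgZ1 : G.gg Z = 1 := by omega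
    rw [hgZ1] at hr
    by_cases h0 : ∃ Z, G.InS t0 Z ∧ G.hh Z = 0
    · obtain ⟨Z, hZ, hZ1⟩ := h0
      have hZb := G.not_both Z
      have hZg := hZ.2
      have hgZ := hi Z hZ (by omega)
      obtain ⟨ε, hε, hr⟩ := G.exists_HR_min Z
      have hgZ1 : G.gg Z = 1 := by omega
      rw [hgZ1] at hr
      refine G.finalI hn hm5 hmax (by omega) (by omega) (by omega) hW hZ (by omega) (Or.inl hZ1)
        (Or.inl ?_)
      obtain ⟨t', l', ⟨S', _⟩, e, f⟩ := G.lap hε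
        (fun t1 => G.InS t0 t1 ∧ G.hh t1 = 0 ∧ G.HR ε t1 1)
        (by
          rintro t1 ⟨S1, h1, r1⟩
          obtain ⟨t2, l2, p2, _, a2, ha2, b2, _⟩ := G.hstep hε r1 (by omega) (by omega)
          unfold LBall at b2
          have h2 := G.hh_nonneg t2
          have hg2 := G.gg_of_HR hε ha2 (by omega) (by omega)
          have S2 : G.InS t0 t2 := ⟨G.le_trans S1.1 l2, by omega⟩
          have := hi t2 S2 (by omega)
          have e2 : a2 = 1 := by omega
          subst e2
          exact ⟨t2, l2, ⟨S2, by omega, ha2⟩, p2⟩) Z ⟨hZ, hZ1, hr⟩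
      rw [hmax t' S'] at f
      exact rowc_full f
    · push Not at h0
      have hall : ∀ t, G.InS t0 t → G.gg t = G.hh t := by
        intro t ht
        by_contra hne
        have := ht.2
        obtain ⟨t', S', g', h'⟩ := drift' 1 (by omega) t ht (by omega)
        have h1 := h0 t' S'
        have h2 := hi t' S' h'
        have := G.hh_nonneg t'
        omega
      have hZ2 : G.hh Z = 1 := by have := h0 Z hZ; omega
      obtain ⟨δ, hδ, hv⟩ := G.exists_VR_min Z
      rw [hZ2] at hv
      refine G.finalII hn hm5 hmax (by omega) (by omega) (by omega) hW hZ hZ2 hδ hv ?_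
      rcases Nat.lt_or_ge m (n + 3) with hmn | hmn
      · -- `m = n + 1`
        have hXK : X ≤ (m - 1) / 2 + 1 := by omega
        by_cases h22 : ∃ t, G.InS t0 t ∧ (G.pos t).2 = (G.pos Z).2 ∧ G.hh t = 2 ∧ G.VR δ t 2
        · obtain ⟨t, St, rt, h2, v2⟩ := h22
          right
          refine ⟨hXK, ?_⟩
          have hgt := hall t St
          rw [← h2] at v2
          have := G.nbr_toward hmax St (by omega) (by omega) hδ v2
          rw [rt] at this
          unfold rowc
          exact Finset.card_pos.mpr ⟨_, Finset.mem_filter.mpr ⟨Finset.mem_univ _, this⟩⟩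
        · left
          obtain ⟨t', l', ⟨S', _⟩, e, f⟩ := G.lap hε
            (fun t1 => G.InS t0 t1 ∧ (G.pos t1).2 = (G.pos Z).2 ∧ G.HR ε t1 1 ∧ G.VR δ t1 1)
            (by
              rintro t1 ⟨S1, q1, r1, v1⟩
              have h1 := G.hh_of_VR hδ v1 (by omega) (by omega)
              obtain ⟨t2, l2, p2, nr, a2, ha2, b2, c2⟩ := G.hstep hε r1 (by omega) (by omega)
              unfold LBall at b2
              have h2 := G.hh_nonneg t2
              have hg2 := G.gg_of_HR hε ha2 (by omega) (by omega)
              have S2 : G.InS t0 t2 := ⟨G.le_trans S1.1 l2, by omega⟩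
              have hgh := hall t2 S2
              have q2 : (G.pos t2).2 = (G.pos Z).2 := by rw [p2]; exact q1
              by_cases ha : a2 = 1
              · subst ha
                refine ⟨t2, l2, ⟨S2, q2, ha2, ?_⟩, p2⟩
                have c3 := c2.resolve_left (by omega)
                unfold VR at *
                rw [c3, p2]; exact v1
              · exfalso
                have hh2 : G.hh t2 = 2 := by omega
                obtain ⟨d, e, hu, _, hy⟩ := nr
                have hv2 : G.VR δ t2 (1 - δ * e) := by
                  unfold VR at *
                  rw [p2, hy]
                  have e2 : ((δ * δ : ℤ) : ZMod n) = 1 := by rcases hδ with rfl | rfl <;> simp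
                  push_cast at e2 v1 ⊢
                  linear_combination v1 - (e : ZMod n) * e2
                have hle := G.hh_le_abs hδ hv2
                have hab := abs_cases (1 - δ * e)
                have e3 : 1 - δ * e = 2 := by
                  unfold UStep at hu
                  rcases hδ with rfl | rfl <;> omega
                rw [e3] at hv2
                exact h22 ⟨t2, S2, q2, hh2, hv2⟩) Z ⟨hZ, rfl, hr, hv⟩
          rw [hmax t' S'] at f
          exact rowc_full f
      · left
        obtain ⟨t', l', ⟨S', _⟩, e, f⟩ := G.lap hε
          (fun t1 => G.InS t0 t1 ∧ ∃ a : ℤ, 1 ≤ a ∧ G.HR ε t1 a ∧ G.hh t1 = a)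
          (by
            rintro t1 ⟨S1, a, a1, r1, h1⟩
            have hn2 : 2 * G.hh t1 ≤ n := cyD_le_half _
            obtain ⟨t2, l2, p2, nr, a2, ha2, b2, c2⟩ := G.hstep hε r1 (by omega) (by omega)
            unfold LBall at b2
            have h2 := G.hh_nonneg t2
            have hg2 := G.gg_of_HR hε ha2 (by omega) (by omega)
            have S2 : G.InS t0 t2 := ⟨G.le_trans S1.1 l2, by omega⟩
            have hgh := hall t2 S2
            have := h0 t2 S2
            exact ⟨t2, l2, ⟨S2, a2, by omega, ha2, by omega⟩, p2⟩) Z ⟨hZ, 1, le_rfl, hr, hZ2⟩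
        rw [hmax t' S'] at f
        exact rowc_full f
  · -- small excess
    have hrow := G.rowK hmax hZ hZ1
    obtain ⟨ε, hε, hv⟩ := G.exists_VR_min Z
    obtain ⟨s, hs1⟩ : ∃ s, s = (n - 1) / 2 := ⟨_, rfl⟩
    obtain ⟨t1, l1, p1⟩ := G.vrun hε s hv (by omega) (by omega)
    obtain ⟨t2, l2, r2, k2⟩ := G.inrow t1
    obtain ⟨y0, hy0⟩ := hW t2
    have h1 := rowc_mono (G.dam_mono (G.le_trans hZ.1 (G.le_trans l1 l2))) (G.pos Z).2
    by_cases c1 : InW n y0 (G.pos Z).2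
    · have c2 : ¬ InW n y0 (G.pos t1).2 := fun h => by
        have e : (G.pos t1).2 = (G.pos Z).2 + ((ε * s : ℤ) : ZMod n) := by
          rw [p1]; push_cast; ring
        rw [e] at h
        have hab : |ε * s| = s := by
          rw [abs_mul, abs_of_nonneg (Int.natCast_nonneg s)]
          rcases hε with rfl | rfl <;> simp
        exact InW_excl c1 h (by omega) (by omega)
      have := win1 hy0 c2
      omega
    · have := win1 hy0 c1
      omega

end
end TGame

open SimpleGraph
/-! ## From the tree of positions to strategies -/
section Assembly
variable {W : Type} (Gr : SimpleGraph W) (CS : CopStrategy W)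

/-- history of the cop against the robber history `ρ` -/
def copH : List W → List W
  | [] => [CS.init]
  | v :: ρ => CS.move (copH ρ) (v :: ρ) :: copH ρ

/-- position of the cop after answering the robber history `ρ` -/
def copA : List W → W
  | [] => CS.init
  | v :: ρ => CS.move (copH CS ρ) (v :: ρ)

/-- strict history of the cop -/
def copT : List W → List W
  | [] => []
  | _ :: ρ => copH CS ρ

theorem copH_eq (ρ : List W) : copH CS ρ = copA CS ρ :: copT CS ρ := by
  cases ρ <;> rfl

/-- legal robber histories in which he was not caught -/
def AliveL : List W → Prop
  | [] => True
  | [v] => v ≠ copA CS [] ∧ copA CS [v] ≠ v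
  | v :: u :: ρ => v ≠ copA CS (u :: ρ) ∧ copA CS (v :: u :: ρ) ≠ v ∧ (u = v ∨ Gr.Adj u v) ∧
      AliveL (u :: ρ)

theorem AliveL.tail {v : W} {ρ : List W} (h : AliveL Gr CS (v :: ρ)) : AliveL Gr CS ρ := by
  cases ρ with
  | nil => trivial
  | cons u ρ => exact h.2.2.2

theorem AliveL.ne1 {v : W} {ρ : List W} (h : AliveL Gr CS (v :: ρ)) : copA CS ρ ≠ v := by
  cases ρ with
  | nil => exact h.1.symm
  | cons u ρ => exact h.1.symm

theorem AliveL.ne2 {v : W} {ρ : List W} (h : AliveL Gr CS (v :: ρ)) : copA CS (v :: ρ) ≠ v := by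
  cases ρ with
  | nil => exact h.2
  | cons u ρ => exact h.2.1

open Classical in
/-- the robber follows the path `ρ` -/
noncomputable def followRS (d : W) (ρ : List W) : RobberStrategy W where
  init _ := ρ.reverse.getD 0 d
  move _ rh := match rh with
    | [] => d
    | r :: rt => if Gr.Adj r (ρ.reverse.getD (rt.length + 1) d) then
        ρ.reverse.getD (rt.length + 1) d else r

theorem followRS_legal (d : W) (ρ : List W) : (followRS Gr d ρ).Legal Gr := by
  intro r ch rh
  simp only [followRS]
  split_ifs with h
  · exact Or.inr h
  · exact Or.inl rfl

theorem suffix_getD (d v : W) {σ ρ : List W} (h : v :: σ <:+ ρ) :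
    ρ.reverse.getD σ.length d = v := by
  obtain ⟨p, rfl⟩ := h
  simp [List.getD_eq_getElem?_getD]

theorem play_follow (d : W) {ρ : List W} (hρ : AliveL Gr CS ρ) : ∀ (σ : List W) (v : W),
    v :: σ <:+ ρ → AliveL Gr CS (v :: σ) →
    play CS (followRS Gr d ρ) σ.length = (copA CS σ, v, copT CS σ, σ) := by
  intro σ
  induction σ with
  | nil =>
    intro v h _
    have := suffix_getD d v h
    simp only [List.length_nil] at this
    simp [play, followRS, copA, copT, this, List.getD_eq_getElem?_getD] at this ⊢
    exact this
  | cons u σ ih =>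
    intro v h ha
    have hs : u :: σ <:+ ρ := (List.suffix_cons v (u :: σ)).trans h
    have h1 := ih u hs (ha.tail)
    have h2 := suffix_getD d v h
    simp only [List.length_cons] at h2
    simp only [List.length_cons, play, h1]
    rw [← copH_eq]
    refine Prod.ext rfl (Prod.ext ?_ rfl)
    simp only [followRS, h2]
    split_ifs with hadj
    · rfl
    · rw [h2] at hadj
      exact ha.2.2.1.resolve_right hadj

theorem follow_safe (d : W) {ρ : List W} (hρ : AliveL Gr CS ρ) : ∀ (σ : List W) (v : W),
    v :: σ <:+ ρ → AliveL Gr CS (v :: σ) → ∀ k ≤ σ.length,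
    copPos CS (followRS Gr d ρ) k ≠ robPos CS (followRS Gr d ρ) k ∧
    copPos CS (followRS Gr d ρ) (k + 1) ≠ robPos CS (followRS Gr d ρ) k := by
  have base : ∀ (σ : List W) (v : W), v :: σ <:+ ρ → AliveL Gr CS (v :: σ) →
      copPos CS (followRS Gr d ρ) σ.length ≠ robPos CS (followRS Gr d ρ) σ.length ∧
      copPos CS (followRS Gr d ρ) (σ.length + 1) ≠ robPos CS (followRS Gr d ρ) σ.length := by
    intro σ v h ha
    have h1 := play_follow Gr CS d hρ σ v h ha
    simp only [copPos, robPos, play, h1]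
    rw [← copH_eq]
    exact ⟨ha.ne1, ha.ne2⟩
  intro σ
  induction σ with
  | nil =>
    intro v h ha k hk
    have : k = 0 := by simpa using hk
    subst this
    exact base [] v h ha
  | cons u σ ih =>
    intro v h ha k hk
    rcases Nat.lt_or_ge k (σ.length + 1) with h1 | h1
    · exact ih u ((List.suffix_cons v (u :: σ)).trans h) ha.tail k (by omega)
    · have : k = (u :: σ).length := by simp only [List.length_cons] at *; omega
      subst this
      exact base (u :: σ) v h ha

theorem AliveL.suffix {σ ρ : List W} (h : σ <:+ ρ) (ha : AliveL Gr CS ρ) : AliveL Gr CS σ := by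
  obtain ⟨p, rfl⟩ := h
  induction p with
  | nil => exact ha
  | cons x p ih => exact ih (AliveL.tail Gr CS ha)

theorem follow_damage (d : W) {ρ : List W} (hρ : AliveL Gr CS ρ) (v : W) (hv : v ∈ ρ) :
    v ∈ damageSet CS (followRS Gr d ρ) := by
  obtain ⟨p, σ, rfl⟩ := List.append_of_mem hv
  have hs : v :: σ <:+ p ++ v :: σ := List.suffix_append p _
  have ha := AliveL.suffix Gr CS hs hρ
  refine ⟨σ.length, ?_, follow_safe Gr CS d hρ σ v hs ha⟩
  rw [robPos, play_follow Gr CS d hρ σ v hs ha]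

/-- closed adjacency -/
def CAdj (u v : W) : Prop := u = v ∨ Gr.Adj u v

theorem le_dmg [Finite W] [Nonempty W] (N : ℕ)
    (h : ∀ CS : CopStrategy W, CS.Legal Gr → ∃ RS : RobberStrategy W, RS.Legal Gr ∧
      N ≤ (damageSet CS RS).ncard) : N ≤ dmg Gr := by
  have hne : { n | ∃ CS : CopStrategy W, CS.Legal Gr ∧
    ∀ RS : RobberStrategy W, RS.Legal Gr → (damageSet CS RS).ncard ≤ n }.Nonempty := by
    obtain ⟨d⟩ := ‹Nonempty W›
    refine ⟨Nat.card W, ⟨d, fun ch _ => ch.headD d⟩, fun c ch rh => Or.inl rfl, fun RS _ => ?_⟩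
    rw [← Set.ncard_univ]
    exact Set.ncard_le_ncard (Set.subset_univ _) Set.finite_univ
  obtain ⟨CS, h1, h2⟩ := Nat.sInf_mem hne
  obtain ⟨RS, h3, h4⟩ := h CS h1
  exact h4.trans (h2 RS h3)

end Assembly

open SimpleGraph
/-! ## The torus -/
section Torus

/-- the torus, with vertices in `ZMod` -/
def torusG (k l : ℕ) : SimpleGraph (ZMod (k + 4) × ZMod (l + 4)) :=
  (cycleGraph (k + 4) □ cycleGraph (l + 4) : SimpleGraph (Fin (k + 4) × Fin (l + 4)))

theorem torusG_adj {k l : ℕ} (u v : ZMod (k + 4) × ZMod (l + 4)) :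
    (torusG k l).Adj u v ↔ ((u.1 - v.1 = 1 ∨ v.1 - u.1 = 1) ∧ u.2 = v.2 ∨
      (u.2 - v.2 = 1 ∨ v.2 - u.2 = 1) ∧ u.1 = v.1) := by
  have h : (torusG k l).Adj u v ↔ ((cycleGraph (k + 4)).Adj u.1 v.1 ∧ u.2 = v.2 ∨
      (cycleGraph (l + 4)).Adj u.2 v.2 ∧ u.1 = v.1) := Iff.rfl
  have h1 : (cycleGraph (k + 4)).Adj u.1 v.1 ↔ (u.1 - v.1 = 1 ∨ v.1 - u.1 = 1) :=
    cycleGraph_adj (n := k + 2)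
  have h2 : (cycleGraph (l + 4)).Adj u.2 v.2 ↔ (u.2 - v.2 = 1 ∨ v.2 - u.2 = 1) :=
    cycleGraph_adj (n := l + 2)
  rw [h, h1, h2]

theorem near_iff {k l : ℕ} (u v : ZMod (k + 4) × ZMod (l + 4)) :
    Near u v ↔ (v = u ∨ (torusG k l).Adj u v) := by
  rw [torusG_adj]
  constructor
  · rintro ⟨d, e, h, h1, h2⟩
    rcases h with ⟨rfl, rfl | rfl | rfl⟩ | ⟨rfl, rfl | rfl⟩
    · left; ext <;> simp [h1, h2]
    all_goals right; simp [h1, h2]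
  · rintro (rfl | ⟨h | h, h'⟩ | ⟨h | h, h'⟩)
    · exact ⟨0, 0, by simp [UStep], by simp, by simp⟩
    · exact ⟨-1, 0, by simp [UStep], by push_cast; linear_combination -h, by simp [h']⟩
    · exact ⟨1, 0, by simp [UStep], by push_cast; linear_combination h, by simp [h']⟩
    · exact ⟨0, -1, by simp [UStep], by simp [h'], by push_cast; linear_combination -h⟩
    · exact ⟨0, 1, by simp [UStep], by simp [h'], by push_cast; linear_combination h⟩

open Classical in
/-- the tree of positions against the cop strategy `CS` -/
noncomputable def stratGame {k l : ℕ} (CS : CopStrategy (ZMod (k + 4) × ZMod (l + 4)))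
    (hCS : CS.Legal (torusG k l)) : TGame (k + 4) (l + 4) where
  T := {ρ : List (ZMod (k + 4) × ZMod (l + 4)) // ρ ≠ [] ∧ AliveL (torusG k l) CS ρ}
  pos t := t.1.head t.2.1
  cp t := copA CS t.1
  dam t := t.1.toFinset
  le a b := a.1 <:+ b.1
  le_refl t := List.suffix_refl _
  le_trans h1 h2 := h1.trans h2
  dam_mono h x hx := by
    rw [List.mem_toFinset] at hx ⊢
    exact h.subset hx
  pos_mem t := by
    rw [List.mem_toFinset]
    exact List.head_mem _
  alive t := by
    obtain ⟨ρ, h1, h2⟩ := t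
    cases ρ with
    | nil => exact absurd rfl h1
    | cons v ρ => exact h2.ne2
  step t v h1 h2 := by
    obtain ⟨ρ, h3, h4⟩ := t
    cases ρ with
    | nil => exact absurd rfl h3
    | cons u ρ =>
      have hn : Near (copA CS (u :: ρ)) (copA CS (v :: u :: ρ)) := by
        rw [near_iff]
        have := hCS (copA CS (u :: ρ)) (copT CS (u :: ρ)) (v :: u :: ρ)
        rw [← copH_eq] at this
        exact this
      have h1' := (near_iff _ _).1 h1
      refine ⟨⟨v :: u :: ρ, by simp, ?_, ?_, ?_, h4⟩, List.suffix_cons _ _, rfl, hn⟩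
      · intro h
        exact h2 ((near_iff _ _).2 (Or.inl h))
      · intro h
        rw [h] at hn
        exact h2 hn
      · exact h1'.imp Eq.symm id
  init := by
    refine ⟨CS.init, fun v hv => ?_⟩
    have hn : Near CS.init (copA CS [v]) := by
      rw [near_iff]
      exact hCS CS.init [] [v]
    refine ⟨⟨[v], by simp, ?_, ?_⟩, rfl, hn⟩
    · intro h
      exact hv ((near_iff _ _).2 (Or.inl h))
    · intro h
      rw [h] at hn
      exact hv hn

theorem torus_le (k l : ℕ) (N : ℕ)
    (h : ∀ G : TGame (k + 4) (l + 4), ∃ t, N ≤ (G.dam t).card) : N ≤ dmg (torusG k l) := by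
  apply le_dmg
  intro CS hCS
  obtain ⟨⟨ρ, h1, h2⟩, ht⟩ := h (stratGame CS hCS)
  refine ⟨followRS (torusG k l) 0 ρ, followRS_legal _ _ _, ht.trans ?_⟩
  rw [← Set.ncard_coe_finset]
  apply Set.ncard_le_ncard _ (Set.toFinite _)
  intro v hv
  have hv' : v ∈ ρ := by simpa [stratGame] using hv
  exact follow_damage _ _ _ h2 v hv'

theorem torus_lower (k l : ℕ) :
    max ((k + 4 - 1) / 2 * (l + 4)) ((l + 4 - 1) / 2 * (k + 4)) ≤ dmg (torusG k l) := by
  refine max_le (torus_le k l _ fun G => G.main (by omega) (by omega))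
    (torus_le k l _ fun G => ?_)
  obtain ⟨t, ht⟩ := G.swap.main (by omega) (by omega)
  refine ⟨t, ht.trans ?_⟩
  simp [TGame.swap]

end Torus

/-! ## The cycle -/
section Cycle

theorem zstep {m : ℕ} [NeZero m] (hm : 4 ≤ m) (t t' : ZMod m) (h1 : 1 ≤ t.val)
    (h2 : t.val ≤ (m - 1) / 2) (hs : t' = t ∨ t' = t + 1 ∨ t' = t - 1)
    (h0 : t' + t' ≠ 0) (h3 : t + t' ≠ 0) : 1 ≤ t'.val ∧ t'.val ≤ (m - 1) / 2 := by
  have hz : ((t.val : ℤ) : ZMod m) = t := by simp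
  generalize t.val = a at *
  have hv : ∀ b : ℕ, b < m → t' = (b : ZMod m) → t'.val = b := by
    intro b hb h
    rw [h, ZMod.val_natCast_of_lt hb]
  rcases hs with rfl | h | h
  · rw [hv a (by omega) (by rw [← hz]; simp)]; omega
  · have e : t' = ((a + 1 : ℕ) : ZMod m) := by rw [h, ← hz]; simp
    rw [hv (a + 1) (by omega) e]
    refine ⟨by omega, ?_⟩
    by_contra hc
    have hc' : m = 2 * a + 1 ∨ m = 2 * a + 2 := by omega
    have hm0 : ((m : ℤ) : ZMod m) = 0 := by simp
    rcases hc' with hc' | hc'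
    · apply h3
      have : (m : ℤ) = 2 * a + 1 := by omega
      rw [this] at hm0
      push_cast at hm0 hz
      rw [h, ← hz]
      linear_combination hm0
    · apply h0
      have : (m : ℤ) = 2 * a + 2 := by omega
      rw [this] at hm0
      push_cast at hm0 hz
      rw [h, ← hz]
      linear_combination hm0
  · have e : t' = ((a - 1 : ℕ) : ZMod m) := by
      rw [h, ← hz]; push_cast [Nat.cast_sub h1]; simp
    rw [hv (a - 1) (by omega) e]
    refine ⟨?_, by omega⟩
    by_contra hc
    apply h0
    rw [e, show a - 1 = 0 by omega]; simp

theorem zstart {m : ℕ} [NeZero m] (hm : 4 ≤ m) (t : ZMod m) (h0 : t + t ≠ 0) :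
    (1 ≤ t.val ∧ t.val ≤ (m - 1) / 2) ∨ (1 ≤ (-t).val ∧ (-t).val ≤ (m - 1) / 2) := by
  have ht : t ≠ 0 := by
    rintro rfl
    simp at h0
  haveI : NeZero t := ⟨ht⟩
  have h1 : t.val < m := ZMod.val_lt t
  have h2 : t.val ≠ 0 := by rwa [Ne, ZMod.val_eq_zero]
  have h3 : (-t).val = m - t.val := ZMod.val_neg_of_ne_zero t
  have h4 : t.val + t.val ≠ m := by
    intro h
    apply h0
    have h5 : ((t.val + t.val : ℕ) : ZMod m) = 0 := by rw [h]; simp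
    push_cast at h5
    simpa using h5
  omega

theorem zcard {m : ℕ} [NeZero m] (K : ℕ) (f : ZMod m → ZMod m) (hf : Function.Injective f) :
    {v : ZMod m | 1 ≤ (f v).val ∧ (f v).val ≤ K}.ncard ≤ K := by
  have h := Set.ncard_le_ncard_of_injOn (s := {v : ZMod m | 1 ≤ (f v).val ∧ (f v).val ≤ K})
    (t := (Finset.Icc 1 K : Finset ℕ)) (fun v => (f v).val)
    (fun v hv => by simpa using hv)
    (fun a _ b _ hab => hf (ZMod.val_injective m hab)) (Finset.finite_toSet _)
  rw [Set.ncard_coe_finset] at h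
  simpa using h

/-- the axis chosen by the cop -/
def axis {m : ℕ} (r : ZMod m) : ZMod m := (((r.val + 1) / 2 : ℕ) : ZMod m)

theorem axis_spec {m : ℕ} [NeZero m] (r : ZMod m) :
    axis r + axis r - r = 0 ∨ axis r + axis r - r = 1 := by
  have hr : ((r.val : ℕ) : ZMod m) = r := by simp
  rcases Nat.even_or_odd' r.val with ⟨b, hb | hb⟩
  · left
    have : axis r = (b : ZMod m) := by unfold axis; congr 1; omega
    rw [this]
    rw [hb] at hr
    push_cast at hr
    linear_combination hr
  · right
    have : axis r = ((b + 1 : ℕ) : ZMod m) := by unfold axis; congr 1; omega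
    rw [this]
    rw [hb] at hr
    push_cast at hr ⊢
    linear_combination hr

open Classical in
/-- the reflecting cop -/
noncomputable def mirrorCS {m : ℕ} (Gr : SimpleGraph (ZMod m)) : CopStrategy (ZMod m) where
  init := 0
  move ch rh := match ch with
    | [] => 0
    | c :: _ => if Gr.Adj c (axis (rh.getLastD 0) + axis (rh.getLastD 0) - rh.headD 0) then
        axis (rh.getLastD 0) + axis (rh.getLastD 0) - rh.headD 0 else c

theorem mirrorCS_legal {m : ℕ} (Gr : SimpleGraph (ZMod m)) : (mirrorCS Gr).Legal Gr := by
  intro c ch rh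
  simp only [mirrorCS]
  split_ifs with h
  · exact Or.inr h
  · exact Or.inl rfl

theorem play_last {W : Type} (d : W) (CS : CopStrategy W) (RS : RobberStrategy W) (i : ℕ) :
    ((play CS RS i).2.1 :: (play CS RS i).2.2.2).getLastD d = robPos CS RS 0 := by
  induction i with
  | zero => simp [play, robPos]
  | succ i ih =>
    rw [← ih]
    simp [play]

theorem rob_step {W : Type} (Gr : SimpleGraph W) (CS : CopStrategy W) (RS : RobberStrategy W)
    (h : RS.Legal Gr) (i : ℕ) : robPos CS RS (i + 1) = robPos CS RS i ∨
      Gr.Adj (robPos CS RS i) (robPos CS RS (i + 1)) := h _ _ _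

theorem mirror_pos {m : ℕ} [NeZero m] (Gr : SimpleGraph (ZMod m))
    (hG : ∀ u v, Gr.Adj u v ↔ (u - v = 1 ∨ v - u = 1)) (RS : RobberStrategy (ZMod m))
    (hRS : RS.Legal Gr) (i : ℕ) : copPos (mirrorCS Gr) RS (i + 1) =
      axis (robPos (mirrorCS Gr) RS 0) + axis (robPos (mirrorCS Gr) RS 0)
        - robPos (mirrorCS Gr) RS i := by
  have key : ∀ i, (copPos (mirrorCS Gr) RS i = axis (robPos (mirrorCS Gr) RS 0)
        + axis (robPos (mirrorCS Gr) RS 0) - robPos (mirrorCS Gr) RS i ∨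
      Gr.Adj (copPos (mirrorCS Gr) RS i) (axis (robPos (mirrorCS Gr) RS 0)
        + axis (robPos (mirrorCS Gr) RS 0) - robPos (mirrorCS Gr) RS i)) →
      copPos (mirrorCS Gr) RS (i + 1) = axis (robPos (mirrorCS Gr) RS 0)
        + axis (robPos (mirrorCS Gr) RS 0) - robPos (mirrorCS Gr) RS i := by
    intro i h
    have hl := play_last 0 (mirrorCS Gr) RS i
    have e : copPos (mirrorCS Gr) RS (i + 1) = (mirrorCS Gr).move
      ((play (mirrorCS Gr) RS i).1 :: (play (mirrorCS Gr) RS i).2.2.1)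
      ((play (mirrorCS Gr) RS i).2.1 :: (play (mirrorCS Gr) RS i).2.2.2) := rfl
    rw [e]
    simp only [mirrorCS] at hl h ⊢
    rw [hl]
    split_ifs with hadj
    · rfl
    · exact h.resolve_right hadj
  induction i with
  | zero =>
    apply key
    have h0 : copPos (mirrorCS Gr) RS 0 = 0 := rfl
    rw [h0, hG]
    rcases axis_spec (robPos (mirrorCS Gr) RS 0) with h | h <;> rw [h] <;> simp
  | succ i ih =>
    apply key
    rw [ih, hG]
    have h := rob_step Gr (mirrorCS Gr) RS hRS i
    rw [hG] at h
    rcases h with h | h | h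
    · left; rw [h]
    · right; right; linear_combination h
    · right; left; linear_combination h

theorem cycle_upper {m : ℕ} [NeZero m] (hm : 4 ≤ m) (Gr : SimpleGraph (ZMod m))
    (hG : ∀ u v, Gr.Adj u v ↔ (u - v = 1 ∨ v - u = 1)) : dmg Gr ≤ (m - 1) / 2 := by
  apply Nat.sInf_le
  refine ⟨mirrorCS Gr, mirrorCS_legal Gr, fun RS hRS => ?_⟩
  set a := axis (robPos (mirrorCS Gr) RS 0) with ha
  set r := robPos (mirrorCS Gr) RS with hr
  have hp := mirror_pos Gr hG RS hRS
  have hst := rob_step Gr (mirrorCS Gr) RS hRS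
  -- non-capture conditions
  have hA : ∀ i, copPos (mirrorCS Gr) RS (i + 1) ≠ r i → (r i - a) + (r i - a) ≠ 0 := by
    intro i h h'
    apply h
    rw [hp i]
    linear_combination -h'
  have hB : ∀ i, copPos (mirrorCS Gr) RS (i + 1) ≠ r (i + 1) →
      (r i - a) + (r (i + 1) - a) ≠ 0 := by
    intro i h h'
    apply h
    rw [hp i]
    linear_combination -h'
  have hS : ∀ i, r (i + 1) - a = r i - a ∨ r (i + 1) - a = r i - a + 1 ∨
      r (i + 1) - a = r i - a - 1 := by
    intro i
    have h := hst i
    rw [hG] at h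
    rcases h with h | h | h
    · left; rw [hr, h]
    · right; right; linear_combination -h
    · right; left; linear_combination h
  by_cases h0 : 1 ≤ (r 0 - a).val ∧ (r 0 - a).val ≤ (m - 1) / 2
  · have hsub : damageSet (mirrorCS Gr) RS ⊆
        {v | 1 ≤ (v - a).val ∧ (v - a).val ≤ (m - 1) / 2} := by
      rintro v ⟨i, rfl, hi⟩
      have : ∀ j ≤ i, 1 ≤ (r j - a).val ∧ (r j - a).val ≤ (m - 1) / 2 := by
        intro j
        induction j with
        | zero => exact fun _ => h0
        | succ j ih =>
          intro hj
          have h := ih (by omega)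
          exact zstep hm _ _ h.1 h.2 (hS j) (hA _ (hi (j + 1) hj).2) (hB _ (hi (j + 1) hj).1)
      exact this i le_rfl
    exact (Set.ncard_le_ncard hsub (Set.toFinite _)).trans
      (zcard _ (fun v => v - a) (sub_left_injective))
  · have hsub : damageSet (mirrorCS Gr) RS ⊆
        {v | 1 ≤ (a - v).val ∧ (a - v).val ≤ (m - 1) / 2} := by
      rintro v ⟨i, rfl, hi⟩
      have h0' := (zstart hm _ (hA 0 (hi 0 (by omega)).2)).resolve_left h0
      rw [neg_sub] at h0'
      have : ∀ j ≤ i, 1 ≤ (a - r j).val ∧ (a - r j).val ≤ (m - 1) / 2 := by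
        intro j
        induction j with
        | zero => exact fun _ => h0'
        | succ j ih =>
          intro hj
          have h := ih (by omega)
          refine zstep hm _ _ h.1 h.2 ?_ ?_ ?_
          · rcases hS j with h | h | h
            · left; linear_combination -h
            · right; right; linear_combination -h
            · right; left; linear_combination -h
          · intro h'
            apply hA _ (hi (j + 1) hj).2
            linear_combination -h'
          · intro h'
            apply hB _ (hi (j + 1) hj).1
            linear_combination -h'
      exact this i le_rfl
    exact (Set.ncard_le_ncard hsub (Set.toFinite _)).trans
      (zcard _ (fun v => a - v) (sub_right_injective))

theorem cycleGraph_upper (k : ℕ) : dmg (cycleGraph (k + 4)) ≤ (k + 4 - 1) / 2 := by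
  have h := cycle_upper (m := k + 4) (by omega)
    (show SimpleGraph (ZMod (k + 4)) from (cycleGraph (k + 4) : SimpleGraph (Fin (k + 4))))
    (fun u v => cycleGraph_adj (n := k + 2))
  exact h

end Cycle

/-- If `m, n ≥ 4` then `dmg(C_m □ C_n) ≥ max {dmg(C_m)·n, dmg(C_n)·m}`, i.e.
`dmg(C_m □ C_n) ≥ max {⌊(m-1)/2⌋·n, ⌊(n-1)/2⌋·m}`. -/
theorem dmg_boxProd_cycles_lower {m n : ℕ} (hm : 4 ≤ m) (hn : 4 ≤ n) :
    max (dmg (cycleGraph m) * n) (dmg (cycleGraph n) * m) ≤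
        dmg (cycleGraph m □ cycleGraph n) ∧
      max ((m - 1) / 2 * n) ((n - 1) / 2 * m) ≤ dmg (cycleGraph m □ cycleGraph n) := by
  obtain ⟨k, rfl⟩ := Nat.exists_eq_add_of_le' hm
  obtain ⟨l, rfl⟩ := Nat.exists_eq_add_of_le' hn
  have h : max ((k + 4 - 1) / 2 * (l + 4)) ((l + 4 - 1) / 2 * (k + 4)) ≤
      dmg (cycleGraph (k + 4) □ cycleGraph (l + 4)) := torus_lower k l
  refine ⟨le_trans (max_le_max ?_ ?_) h, h⟩
  · exact Nat.mul_le_mul_right _ (cycleGraph_upper k)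
  · exact Nat.mul_le_mul_right _ (cycleGraph_upper l)
end
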